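/- arXiv:1404.3000 — 2 statements merged into one kernel-verified Lean document; each statement's English description precedes it below -/
import Mathlib

section
/- Every lattice polytope P of dimension d in a lattice M can be written, in the free abelian group on lattice polytopes modulo the relations generated by regular subdivisions, the empty polytope, and unimodular equivalence, as an integer combination of unimodular simplices. -/
/- Statement 5: every lattice polytope is, modulo the relations generated by regular
subdivisions, the empty polytope and unimodular equivalence, an integer combination of
unimodular simplices. -/

open Classical Polynomial Pointwise
noncomputable section

abbrev Euc (n : ℕ) := Fin n → ℝ

def IsPolytope {n : ℕ} (P : Set (Euc n)) : Prop :=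
  ∃ V : Finset (Euc n), P = convexHull ℝ (V : Set (Euc n))

def intPt {n : ℕ} (v : Fin n → ℤ) : Euc n := fun i => (v i : ℝ)

def IsLatticePolytope {n : ℕ} (P : Set (Euc n)) : Prop :=
  ∃ V : Finset (Fin n → ℤ), P = convexHull ℝ (intPt '' (V : Set (Fin n → ℤ)))

def latticePts {n : ℕ} (P : Set (Euc n)) : Set (Fin n → ℤ) := {v | intPt v ∈ P}

def pdim {n : ℕ} (P : Set (Euc n)) : ℕ := Module.finrank ℝ (vectorSpan ℝ P)

def relBoundary {n : ℕ} (P : Set (Euc n)) : Set (Euc n) := P \ intrinsicInterior ℝ P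

structure Subdivision {n : ℕ} (P : Set (Euc n)) where
  cells : Finset (Set (Euc n))
  nonempty_cells : ∀ F ∈ cells, (F : Set (Euc n)).Nonempty
  poly : ∀ F ∈ cells, IsPolytope F
  cover : (⋃ F ∈ cells, F) = P
  inter_face : ∀ F ∈ cells, ∀ G ∈ cells, IsExposed ℝ F (F ∩ G) ∧ IsExposed ℝ G (F ∩ G)
  face_mem : ∀ F ∈ cells, ∀ G : Set (Euc n), IsExposed ℝ F G → G.Nonempty → G ∈ cells

def liftedPts {n : ℕ} (P : Set (Euc n)) (ω : (Fin n → ℤ) → ℝ) : Set (Euc n × ℝ) :=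
  {p | ∃ v ∈ latticePts P, p = (intPt v, ω v)}

def lowerEnv {n : ℕ} (P : Set (Euc n)) (ω : (Fin n → ℤ) → ℝ) (x : Euc n) : ℝ :=
  sInf {t | (x, t) ∈ convexHull ℝ (liftedPts P ω)}

def IsRegularCell {n : ℕ} (P : Set (Euc n)) (ω : (Fin n → ℤ) → ℝ) (F : Set (Euc n)) :
    Prop :=
  F.Nonempty ∧ ∃ a : Euc n →ᵃ[ℝ] ℝ, (∀ x ∈ P, a x ≤ lowerEnv P ω x) ∧
    F = {x ∈ P | a x = lowerEnv P ω x}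

def IsRegularSubdivision {n : ℕ} (P : Set (Euc n)) (S : Subdivision P) : Prop :=
  ∃ ω : (Fin n → ℤ) → ℝ, (↑S.cells : Set (Set (Euc n))) = {F | IsRegularCell P ω F}

def unimodMap {n : ℕ} (A : Matrix (Fin n) (Fin n) ℤ) (u : Fin n → ℤ) (x : Euc n) :
    Euc n :=
  (A.map (Int.cast : ℤ → ℝ)).mulVec x + intPt u

def stdSimplexSet (n k : ℕ) : Set (Euc n) :=
  convexHull ℝ (insert 0
    (Set.range fun j : Fin k => fun i : Fin n => if (i : ℕ) = (j : ℕ) then (1 : ℝ) else 0))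

def IsUnimodularSimplex {n : ℕ} (P : Set (Euc n)) : Prop :=
  ∃ k : ℕ, k ≤ n ∧ ∃ A : Matrix (Fin n) (Fin n) ℤ, IsUnit A.det ∧ ∃ u : Fin n → ℤ,
    P = unimodMap A u '' stdSimplexSet n k

/-- Generators of the subgroup H of the free abelian group on lattice polytopes:
subdivision relations for regular lattice subdivisions, the empty polytope, and
unimodular equivalences. -/
def relationSet (n : ℕ) : Set (FreeAbelianGroup (Set (Euc n))) :=
  {x | (∃ P : Set (Euc n), ∃ S : Subdivision P, IsLatticePolytope P ∧
          (∀ F ∈ S.cells, IsLatticePolytope F) ∧ IsRegularSubdivision P S ∧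
          x = FreeAbelianGroup.of P - ∑ F ∈ S.cells,
            (if F ⊆ relBoundary P then 0
             else ((-1 : ℤ) ^ (pdim P - pdim F)) • FreeAbelianGroup.of F))
    ∨ x = FreeAbelianGroup.of (∅ : Set (Euc n))
    ∨ (∃ P : Set (Euc n), ∃ A : Matrix (Fin n) (Fin n) ℤ, ∃ u : Fin n → ℤ,
          IsLatticePolytope P ∧ IsUnit A.det ∧
          x = FreeAbelianGroup.of (unimodMap A u '' P) - FreeAbelianGroup.of P)}

/-! ### Convex hulls of indexed finite families -/

lemma mem_hull_iff {E ι : Type*} [AddCommGroup E] [Module ℝ E] (L : Finset ι) (pt : ι → E)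
    (x : E) : x ∈ convexHull ℝ (pt '' (L : Set ι)) ↔
      ∃ c : ι → ℝ, (∀ i ∈ L, 0 ≤ c i) ∧ ∑ i ∈ L, c i = 1 ∧ ∑ i ∈ L, c i • pt i = x := by
  constructor
  · intro hx
    have hconv : Convex ℝ {y : E | ∃ c : ι → ℝ, (∀ i ∈ L, 0 ≤ c i) ∧ ∑ i ∈ L, c i = 1 ∧
        ∑ i ∈ L, c i • pt i = y} := by
      rintro y ⟨c, hc0, hc1, rfl⟩ z ⟨d, hd0, hd1, rfl⟩ s t hs ht hst
      refine ⟨fun i => s * c i + t * d i, fun i hi => ?_, ?_, ?_⟩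
      · have := hc0 i hi
        have := hd0 i hi
        positivity
      · rw [Finset.sum_add_distrib, ← Finset.mul_sum, ← Finset.mul_sum, hc1, hd1]
        linarith
      · simp only [add_smul, mul_smul, Finset.sum_add_distrib, Finset.smul_sum]
    refine convexHull_min ?_ hconv hx
    rintro _ ⟨j, hj, rfl⟩
    refine ⟨fun i => if i = j then 1 else 0, fun i _ => ?_, ?_, ?_⟩
    · dsimp only
      split_ifs <;> norm_num
    · rw [Finset.sum_ite_eq' L j, if_pos (by exact_mod_cast hj)]
    · simp only [ite_smul, one_smul, zero_smul]
      rw [Finset.sum_ite_eq' L j, if_pos (by exact_mod_cast hj)]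
  · rintro ⟨c, hc0, hc1, rfl⟩
    refine (convex_convexHull ℝ _).sum_mem hc0 hc1 fun i hi => ?_
    exact subset_convexHull ℝ _ ⟨i, by exact_mod_cast hi, rfl⟩

lemma affine_comb {n : ℕ} {ι : Type*} (L : Finset ι) (pt : ι → Euc n) (a : Euc n →ᵃ[ℝ] ℝ)
    (c : ι → ℝ) : a (∑ i ∈ L, c i • pt i) + (∑ i ∈ L, c i - 1) * a 0 =
      ∑ i ∈ L, c i * a (pt i) := by
  have h : ∀ y, a y = a.linear y + a 0 := fun y => by
    have := a.map_vadd 0 y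
    simpa using this
  rw [h (∑ i ∈ L, c i • pt i), map_sum]
  rw [Finset.sum_congr rfl (fun i _ => by rw [h (pt i), mul_add] :
    ∀ i ∈ L, c i * a (pt i) = c i * a.linear (pt i) + c i * a 0)]
  rw [Finset.sum_add_distrib, ← Finset.sum_mul]
  simp only [map_smul, smul_eq_mul]
  ring

lemma affine_comb_one {n : ℕ} {ι : Type*} (L : Finset ι) (pt : ι → Euc n) (a : Euc n →ᵃ[ℝ] ℝ)
    (c : ι → ℝ) (hc : ∑ i ∈ L, c i = 1) : a (∑ i ∈ L, c i • pt i) =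
      ∑ i ∈ L, c i * a (pt i) := by
  rw [← affine_comb, hc]; ring

lemma affine_le_hull {n : ℕ} {ι : Type*} (L : Finset ι) (pt : ι → Euc n) (a : Euc n →ᵃ[ℝ] ℝ)
    (r : ℝ) (h : ∀ i ∈ L, a (pt i) ≤ r) {x : Euc n} (hx : x ∈ convexHull ℝ (pt '' (L : Set ι))) :
    a x ≤ r := by
  obtain ⟨c, hc0, hc1, rfl⟩ := (mem_hull_iff L pt x).1 hx
  rw [affine_comb_one _ _ _ _ hc1]
  calc ∑ i ∈ L, c i * a (pt i) ≤ ∑ i ∈ L, c i * r :=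
        Finset.sum_le_sum fun i hi => mul_le_mul_of_nonneg_left (h i hi) (hc0 i hi)
    _ = r := by rw [← Finset.sum_mul, hc1, one_mul]

/-- Points of the hull where an affine function attains its upper bound. -/
lemma mem_hull_tight {n : ℕ} {ι : Type*} (L : Finset ι) (pt : ι → Euc n) (f : ι → ℝ)
    (hf : ∀ i ∈ L, 0 ≤ f i) (c : ι → ℝ) (hc0 : ∀ i ∈ L, 0 ≤ c i) (hc1 : ∑ i ∈ L, c i = 1)
    (hs : ∑ i ∈ L, c i * f i = 0) :
    ∑ i ∈ L, c i • pt i ∈ convexHull ℝ (pt '' ((L.filter fun i => f i = 0 : Finset ι) : Set ι)) := by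
  have h0 : ∀ i ∈ L, c i * f i = 0 :=
    (Finset.sum_eq_zero_iff_of_nonneg fun i hi => mul_nonneg (hc0 i hi) (hf i hi)).1 hs
  rw [mem_hull_iff]
  have hz : ∀ i ∈ L, i ∉ L.filter (fun i => f i = 0) → c i = 0 := by
    intro i hi hi'
    have : f i ≠ 0 := fun h => hi' (Finset.mem_filter.2 ⟨hi, h⟩)
    exact (mul_eq_zero.1 (h0 i hi)).resolve_right this
  refine ⟨c, fun i hi => hc0 i (Finset.mem_filter.1 hi).1, ?_, ?_⟩
  · rw [← hc1]
    exact Finset.sum_subset (Finset.filter_subset _ _) hz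
  · exact Finset.sum_subset (Finset.filter_subset _ _) fun i hi hi' => by rw [hz i hi hi', zero_smul]

/-! ### Linear programming duality -/

def Feas {n : ℕ} {ι : Type*} (L : Finset ι) (pt : ι → Euc n) (w : ι → ℝ)
    (a : Euc n →ᵃ[ℝ] ℝ) : Prop := ∀ i ∈ L, a (pt i) ≤ w i

def tight {n : ℕ} {ι : Type*} (L : Finset ι) (pt : ι → Euc n) (w : ι → ℝ)
    (a : Euc n →ᵃ[ℝ] ℝ) : Finset ι := L.filter fun i => a (pt i) = w i

def Rigid {n : ℕ} {ι : Type*} (L : Finset ι) (pt : ι → Euc n) (w : ι → ℝ)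
    (a : Euc n →ᵃ[ℝ] ℝ) : Prop :=
  ∀ l : Euc n →ᵃ[ℝ] ℝ, (∀ i ∈ tight L pt w a, l (pt i) = 0) → ∀ i ∈ L, l (pt i) = 0

lemma improve_step {n : ℕ} {ι : Type*} (L : Finset ι) (pt : ι → Euc n) (w : ι → ℝ)
    (a l : Euc n →ᵃ[ℝ] ℝ) (ha : Feas L pt w a) (hl : ∀ i ∈ tight L pt w a, l (pt i) = 0)
    (x : Euc n) (hlx : 0 ≤ l x) (j : ι) (hj : j ∈ L) (hlj : 0 < l (pt j)) :
    ∃ b, Feas L pt w b ∧ a x ≤ b x ∧ (tight L pt w a).card < (tight L pt w b).card := by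
  obtain ⟨k, hk, hmin⟩ := (L.filter fun i => 0 < l (pt i)).exists_min_image
    (fun i => (w i - a (pt i)) / l (pt i)) ⟨j, Finset.mem_filter.2 ⟨hj, hlj⟩⟩
  obtain ⟨hkL, hlk⟩ := Finset.mem_filter.1 hk
  set t := (w k - a (pt k)) / l (pt k) with ht
  have ht0 : 0 ≤ t := div_nonneg (sub_nonneg.2 (ha k hkL)) hlk.le
  have hb : ∀ y, (a + t • l) y = a y + t * l y := fun y => by simp
  refine ⟨a + t • l, ?_, ?_, ?_⟩
  · intro i hi
    rw [hb]
    by_cases h : 0 < l (pt i)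
    · have := hmin i (Finset.mem_filter.2 ⟨hi, h⟩)
      rw [le_div_iff₀ h] at this
      linarith
    · have := mul_nonneg ht0 (neg_nonneg.2 (not_lt.1 h))
      have := ha i hi
      linarith
  · rw [hb]; have := mul_nonneg ht0 hlx; linarith
  · apply Finset.card_lt_card
    rw [Finset.ssubset_iff_of_subset]
    · refine ⟨k, Finset.mem_filter.2 ⟨hkL, ?_⟩, fun h => hlk.ne' (hl k h)⟩
      rw [hb, ht]; field_simp; ring
    · intro i hi
      refine Finset.mem_filter.2 ⟨(Finset.mem_filter.1 hi).1, ?_⟩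
      rw [hb, hl i hi, (Finset.mem_filter.1 hi).2]; ring

lemma exists_rigid {n : ℕ} {ι : Type*} (L : Finset ι) (pt : ι → Euc n) (w : ι → ℝ)
    (x : Euc n) (hx : x ∈ convexHull ℝ (pt '' (L : Set ι))) (m : ℕ) :
    ∀ a, Feas L pt w a → L.card - (tight L pt w a).card = m →
    ∃ b, Feas L pt w b ∧ a x ≤ b x ∧ Rigid L pt w b := by
  induction m using Nat.strong_induction_on with
  | _ m ih =>
  intro a ha hm
  by_cases hr : Rigid L pt w a
  · exact ⟨a, ha, le_rfl, hr⟩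
  unfold Rigid at hr
  push Not at hr
  obtain ⟨l, hl, j, hj, hlj⟩ := hr
  have key : ∃ l' : Euc n →ᵃ[ℝ] ℝ, (∀ i ∈ tight L pt w a, l' (pt i) = 0) ∧ 0 ≤ l' x ∧
      ∃ j ∈ L, 0 < l' (pt j) := by
    have hneg : ∀ i ∈ tight L pt w a, (-l) (pt i) = 0 := fun i hi => by simp [hl i hi]
    have hpos : ∀ l' : Euc n →ᵃ[ℝ] ℝ, 0 < l' x → ∃ j ∈ L, 0 < l' (pt j) := by
      intro l' h
      by_contra hcon
      push Not at hcon
      exact absurd (affine_le_hull L pt l' 0 hcon hx) (not_le.2 h)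
    rcases lt_trichotomy (l x) 0 with h | h | h
    · have : 0 < (-l) x := by simpa using h
      exact ⟨-l, hneg, this.le, hpos _ this⟩
    · rcases lt_or_gt_of_ne hlj with h' | h'
      · exact ⟨-l, hneg, by simp [h], j, hj, by simpa using h'⟩
      · exact ⟨l, hl, h.ge, j, hj, h'⟩
    · exact ⟨l, hl, h.le, hpos _ h⟩
  obtain ⟨l', hl', hlx, k, hk, hlk⟩ := key
  obtain ⟨b, hb, hab, hcard⟩ := improve_step L pt w a l' ha hl' x hlx k hk hlk
  have hle : (tight L pt w b).card ≤ L.card := Finset.card_le_card (Finset.filter_subset _ _)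
  obtain ⟨b', hb', hbb', hr'⟩ := ih _ (by omega) b hb rfl
  exact ⟨b', hb', hab.trans hbb', hr'⟩

lemma exists_opt {n : ℕ} {ι : Type*} (L : Finset ι) (pt : ι → Euc n) (w : ι → ℝ)
    (x : Euc n) (hx : x ∈ convexHull ℝ (pt '' (L : Set ι))) :
    ∃ a, Feas L pt w a ∧ ∀ b, Feas L pt w b → b x ≤ a x := by
  have hne : L.Nonempty := by
    by_contra h
    rw [Finset.not_nonempty_iff_eq_empty] at h
    subst h
    simp at hx
  have hfin : ({r : ℝ | ∃ a, Feas L pt w a ∧ Rigid L pt w a ∧ a x = r}).Finite := by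
    have : ∀ r : {r : ℝ | ∃ a, Feas L pt w a ∧ Rigid L pt w a ∧ a x = r},
        ∃ a, Feas L pt w a ∧ Rigid L pt w a ∧ a x = r.1 := fun r => r.2
    choose A hA1 hA2 hA3 using this
    have hinj : Function.Injective (fun r => (⟨tight L pt w (A r),
        Finset.mem_powerset.2 (Finset.filter_subset _ _)⟩ : L.powerset)) := by
      intro r s hrs
      have hrs' : tight L pt w (A r) = tight L pt w (A s) := congrArg Subtype.val hrs
      have h0 := hA2 r (A r - A s) (fun i hi => by
        have h1 := (Finset.mem_filter.1 hi).2
        have h2 := (Finset.mem_filter.1 (hrs' ▸ hi)).2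
        simp [h1, h2])
      have h1 := affine_le_hull L pt (A r - A s) 0 (fun i hi => (h0 i hi).le) hx
      have h2 := affine_le_hull L pt (A s - A r) 0 (fun i hi => by
        have := h0 i hi
        simp only [AffineMap.coe_sub, Pi.sub_apply] at this ⊢
        linarith) hx
      simp only [AffineMap.coe_sub, Pi.sub_apply] at h1 h2
      apply Subtype.ext
      rw [← hA3 r, ← hA3 s]
      linarith
    exact Set.finite_coe_iff.1 (Finite.of_injective _ hinj)
  have hfeas : ∃ a, Feas L pt w a := by
    obtain ⟨k, _, hk⟩ := L.exists_min_image w hne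
    exact ⟨AffineMap.const ℝ _ (w k), fun i hi => by simpa using hk i hi⟩
  obtain ⟨a0, ha0⟩ := hfeas
  obtain ⟨b0, hb0, _, hr0⟩ := exists_rigid L pt w x hx _ a0 ha0 rfl
  obtain ⟨r, ⟨a, ha, hra, rfl⟩, hmax⟩ := hfin.exists_maximal ⟨b0 x, b0, hb0, hr0, rfl⟩
  refine ⟨a, ha, fun b hb => ?_⟩
  obtain ⟨b', hb', hbb', hr'⟩ := exists_rigid L pt w x hx _ b hb rfl
  have : b' x ≤ a x := by
    rcases le_total (b' x) (a x) with h | h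
    · exact h
    · exact hmax ⟨b', hb', hr', rfl⟩ h
  exact hbb'.trans this

/-- Small perturbations: if `f > 0` off the zero set, add `e * g`. -/
lemma exists_small {ι : Type*} (L : Finset ι) (f g : ι → ℝ) (hf : ∀ i ∈ L, 0 ≤ f i) :
    ∃ e : ℝ, 0 < e ∧ ∀ i ∈ L, f i ≠ 0 → e * g i < f i := by
  induction L using Finset.induction_on with
  | empty => exact ⟨1, one_pos, by simp⟩
  | insert j L hj ih =>
    obtain ⟨e, he, h⟩ := ih fun i hi => hf i (Finset.mem_insert_of_mem hi)
    by_cases hfj : f j = 0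
    · refine ⟨e, he, fun i hi hne => ?_⟩
      rcases Finset.mem_insert.1 hi with rfl | hi
      · exact absurd hfj hne
      · exact h i hi hne
    have hpos : 0 < f j := lt_of_le_of_ne (hf j (Finset.mem_insert_self _ _)) (Ne.symm hfj)
    refine ⟨min e (f j / (|g j| + 1)), lt_min he (by positivity), fun i hi hne => ?_⟩
    rcases Finset.mem_insert.1 hi with rfl | hi
    · have h1 : 0 < min e (f i / (|g i| + 1)) := lt_min he (by positivity)
      have h2 := min_le_right e (f i / (|g i| + 1))
      rw [le_div_iff₀ (by positivity)] at h2
      nlinarith [le_abs_self (g i)]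
    · have h1 : 0 < min e (f j / (|g j| + 1)) := lt_min he (by positivity)
      have h2 := min_le_left e (f j / (|g j| + 1))
      have h3 := h i hi hne
      have h4 := hf i (Finset.mem_insert_of_mem hi)
      have h5 : 0 < f i := lt_of_le_of_ne h4 (Ne.symm hne)
      rcases le_total 0 (g i) with hg | hg
      · nlinarith
      · nlinarith

lemma exists_cover {n : ℕ} {ι : Type*} (L : Finset ι) (pt : ι → Euc n) (w : ι → ℝ)
    (x : Euc n) (hx : x ∈ convexHull ℝ (pt '' (L : Set ι))) :
    ∃ a, Feas L pt w a ∧ x ∈ convexHull ℝ (pt '' (tight L pt w a : Set ι)) := by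
  obtain ⟨a, ha, hopt⟩ := exists_opt L pt w x hx
  refine ⟨a, ha, ?_⟩
  by_contra hcon
  have hcl : IsClosed (convexHull ℝ (pt '' (tight L pt w a : Set ι))) :=
    Set.Finite.isClosed_convexHull (𝕜 := ℝ) ((Finset.finite_toSet _).image _)
  obtain ⟨f, u, hfu, hux⟩ := geometric_hahn_banach_closed_point (convex_convexHull ℝ _) hcl hcon
  let l : Euc n →ᵃ[ℝ] ℝ := (f : Euc n →ₗ[ℝ] ℝ).toAffineMap - AffineMap.const ℝ _ u
  have hl : ∀ y, l y = f y - u := fun y => by simp [l]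
  obtain ⟨e, he, hee⟩ := exists_small L (fun i => w i - a (pt i)) (fun i => l (pt i))
    (fun i hi => sub_nonneg.2 (ha i hi))
  have hb : ∀ y, (a + e • l) y = a y + e * l y := fun y => by simp
  have := hopt (a + e • l) (fun i hi => by
    rw [hb]
    by_cases h : a (pt i) = w i
    · have h1 := hfu (pt i) (subset_convexHull ℝ _ ⟨i, by
        exact_mod_cast Finset.mem_filter.2 ⟨hi, h⟩, rfl⟩)
      have : l (pt i) < 0 := by rw [hl]; linarith
      nlinarith
    · have := hee i hi (sub_ne_zero.2 (Ne.symm h))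
      linarith)
  rw [hb, hl] at this
  nlinarith

/-! ### Regular subdivisions -/

lemma latticePts_finite {n : ℕ} {P : Set (Euc n)} (hP : IsLatticePolytope P) :
    (latticePts P).Finite := by
  obtain ⟨V, rfl⟩ := hP
  have hc : IsCompact (convexHull ℝ (intPt '' (V : Set (Fin n → ℤ)))) :=
    Set.Finite.isCompact_convexHull (𝕜 := ℝ) ((Finset.finite_toSet _).image _)
  obtain ⟨R, hR⟩ := hc.isBounded.exists_norm_le
  refine (Set.finite_Icc (fun _ : Fin n => -⌈R⌉) (fun _ => ⌈R⌉)).subset ?_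
  intro v hv
  have h1 : ∀ i, |(v i : ℝ)| ≤ R := fun i =>
    (norm_le_pi_norm (intPt v) i).trans (hR _ hv)
  have h2 : ∀ i, |v i| ≤ ⌈R⌉ := fun i => by
    have := (h1 i).trans (Int.le_ceil R)
    exact_mod_cast this
  exact ⟨fun i => (abs_le.1 (h2 i)).1, fun i => (abs_le.1 (h2 i)).2⟩

lemma hull_latticePts {n : ℕ} {P : Set (Euc n)} (hP : IsLatticePolytope P) :
    P = convexHull ℝ (intPt '' (latticePts P)) := by
  obtain ⟨V, hV⟩ := hP
  apply Set.Subset.antisymm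
  · conv_lhs => rw [hV]
    apply convexHull_mono
    apply Set.image_mono
    intro v hv
    change intPt v ∈ P
    rw [hV]
    exact subset_convexHull ℝ _ ⟨v, hv, rfl⟩
  · apply convexHull_min
    · rintro _ ⟨v, hv, rfl⟩
      exact hv
    · rw [hV]
      exact convex_convexHull ℝ _

lemma liftedPts_eq {n : ℕ} (P : Set (Euc n)) (w : (Fin n → ℤ) → ℝ) (L : Finset (Fin n → ℤ))
    (hL : (L : Set (Fin n → ℤ)) = latticePts P) :
    liftedPts P w = (fun v => (intPt v, w v)) '' (L : Set (Fin n → ℤ)) := by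
  ext p
  rw [hL]
  constructor
  · rintro ⟨v, hv, rfl⟩
    exact ⟨v, hv, rfl⟩
  · rintro ⟨v, hv, rfl⟩
    exact ⟨v, hv, rfl⟩

lemma mem_lifted_iff {n : ℕ} (P : Set (Euc n)) (w : (Fin n → ℤ) → ℝ) (L : Finset (Fin n → ℤ))
    (hL : (L : Set (Fin n → ℤ)) = latticePts P) (x : Euc n) (t : ℝ) :
    (x, t) ∈ convexHull ℝ (liftedPts P w) ↔ ∃ c : (Fin n → ℤ) → ℝ, (∀ i ∈ L, 0 ≤ c i) ∧
      ∑ i ∈ L, c i = 1 ∧ ∑ i ∈ L, c i • intPt i = x ∧ ∑ i ∈ L, c i * w i = t := by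
  rw [liftedPts_eq P w L hL, mem_hull_iff]
  refine exists_congr fun c => and_congr_right fun _ => and_congr_right fun _ => ?_
  rw [Prod.ext_iff, Prod.fst_sum, Prod.snd_sum]
  simp

lemma lifted_ge {n : ℕ} {P : Set (Euc n)} {w : (Fin n → ℤ) → ℝ} {L : Finset (Fin n → ℤ)}
    (hL : (L : Set (Fin n → ℤ)) = latticePts P) {a : Euc n →ᵃ[ℝ] ℝ} (ha : Feas L intPt w a)
    {x : Euc n} {t : ℝ} (h : (x, t) ∈ convexHull ℝ (liftedPts P w)) : a x ≤ t := by
  obtain ⟨c, hc0, hc1, rfl, rfl⟩ := (mem_lifted_iff P w L hL x t).1 h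
  rw [affine_comb_one _ _ _ _ hc1]
  exact Finset.sum_le_sum fun i hi => mul_le_mul_of_nonneg_left (ha i hi) (hc0 i hi)

lemma tight_lifted {n : ℕ} {P : Set (Euc n)} {w : (Fin n → ℤ) → ℝ} {L : Finset (Fin n → ℤ)}
    (hL : (L : Set (Fin n → ℤ)) = latticePts P) {a : Euc n →ᵃ[ℝ] ℝ}
    {x : Euc n} (hx : x ∈ convexHull ℝ (intPt '' (tight L intPt w a : Set (Fin n → ℤ)))) :
    (x, a x) ∈ convexHull ℝ (liftedPts P w) := by
  obtain ⟨c, hc0, hc1, rfl⟩ := (mem_hull_iff _ _ _).1 hx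
  rw [affine_comb_one _ _ _ _ hc1]
  have : (∑ i ∈ tight L intPt w a, c i • intPt i, ∑ i ∈ tight L intPt w a, c i * a (intPt i)) =
      ∑ i ∈ tight L intPt w a, c i • ((intPt i, w i) : Euc n × ℝ) := by
    rw [Prod.ext_iff, Prod.fst_sum, Prod.snd_sum]
    refine ⟨rfl, Finset.sum_congr rfl fun i hi => ?_⟩
    rw [(Finset.mem_filter.1 hi).2]
    rfl
  rw [this]
  refine (convex_convexHull ℝ _).sum_mem hc0 hc1 fun i hi => subset_convexHull ℝ _ ⟨i, ?_, rfl⟩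
  rw [← hL]
  exact_mod_cast (Finset.mem_filter.1 hi).1

lemma lowerEnv_eq {n : ℕ} {P : Set (Euc n)} {w : (Fin n → ℤ) → ℝ} {L : Finset (Fin n → ℤ)}
    (hL : (L : Set (Fin n → ℤ)) = latticePts P) {a : Euc n →ᵃ[ℝ] ℝ} (ha : Feas L intPt w a)
    {x : Euc n} (hx : x ∈ convexHull ℝ (intPt '' (tight L intPt w a : Set (Fin n → ℤ)))) :
    lowerEnv P w x = a x :=
  IsLeast.csInf_eq ⟨tight_lifted hL hx, fun _ ht => lifted_ge hL ha ht⟩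

lemma le_lowerEnv_iff {n : ℕ} {P : Set (Euc n)} (hP : IsLatticePolytope P)
    {w : (Fin n → ℤ) → ℝ} {L : Finset (Fin n → ℤ)}
    (hL : (L : Set (Fin n → ℤ)) = latticePts P) (a : Euc n →ᵃ[ℝ] ℝ) :
    (∀ x ∈ P, a x ≤ lowerEnv P w x) ↔ Feas L intPt w a := by
  constructor
  · intro h v hv
    have hvP : v ∈ latticePts P := by rw [← hL]; exact_mod_cast hv
    have hvP' : intPt v ∈ convexHull ℝ (intPt '' (L : Set (Fin n → ℤ))) :=
      subset_convexHull ℝ _ ⟨v, by exact_mod_cast hv, rfl⟩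
    obtain ⟨b, hb, hvb⟩ := exists_cover L intPt w (intPt v) hvP'
    have h1 := h _ hvP
    rw [lowerEnv_eq hL hb hvb] at h1
    exact h1.trans (hb v hv)
  · intro ha x hx
    rw [hull_latticePts hP, ← hL] at hx
    obtain ⟨b, hb, hxb⟩ := exists_cover L intPt w x hx
    rw [lowerEnv_eq hL hb hxb]
    exact lifted_ge hL ha (tight_lifted hL hxb)

lemma cell_eq {n : ℕ} {P : Set (Euc n)} (hP : IsLatticePolytope P)
    {w : (Fin n → ℤ) → ℝ} {L : Finset (Fin n → ℤ)}
    (hL : (L : Set (Fin n → ℤ)) = latticePts P) {a : Euc n →ᵃ[ℝ] ℝ} (ha : Feas L intPt w a) :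
    {x ∈ P | a x = lowerEnv P w x} =
      convexHull ℝ (intPt '' (tight L intPt w a : Set (Fin n → ℤ))) := by
  ext x
  constructor
  · rintro ⟨hx, hax⟩
    rw [hull_latticePts hP, ← hL] at hx
    obtain ⟨b, hb, hxb⟩ := exists_cover L intPt w x hx
    have h := tight_lifted hL hxb
    rw [← lowerEnv_eq hL hb hxb, ← hax] at h
    obtain ⟨c, hc0, hc1, hcx, hct⟩ := (mem_lifted_iff P w L hL _ _).1 h
    have := mem_hull_tight L intPt (fun i => w i - a (intPt i)) (fun i hi => sub_nonneg.2 (ha i hi))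
      c hc0 hc1 (by
        simp only [mul_sub, Finset.sum_sub_distrib]
        rw [← affine_comb_one _ _ _ _ hc1, hcx, hct, sub_self])
    rw [hcx] at this
    have he : L.filter (fun i => w i - a (intPt i) = 0) = tight L intPt w a :=
      Finset.filter_congr fun i _ => by rw [sub_eq_zero, eq_comm]
    rwa [he] at this
  · intro hx
    refine ⟨?_, (lowerEnv_eq hL ha hx).symm⟩
    rw [hull_latticePts hP, ← hL]
    exact convexHull_mono (Set.image_mono (by exact_mod_cast Finset.filter_subset _ _)) hx

lemma regularCell_iff {n : ℕ} {P : Set (Euc n)} (hP : IsLatticePolytope P)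
    {w : (Fin n → ℤ) → ℝ} {L : Finset (Fin n → ℤ)}
    (hL : (L : Set (Fin n → ℤ)) = latticePts P) (F : Set (Euc n)) :
    IsRegularCell P w F ↔ F.Nonempty ∧ ∃ a, Feas L intPt w a ∧
      F = convexHull ℝ (intPt '' (tight L intPt w a : Set (Fin n → ℤ))) := by
  refine and_congr_right fun _ => exists_congr fun a => ?_
  rw [le_lowerEnv_iff hP hL]
  refine and_congr_right fun ha => ?_
  rw [cell_eq hP hL ha]

lemma cell_exposed {n : ℕ} {P : Set (Euc n)} {w : (Fin n → ℤ) → ℝ} {a b : Euc n →ᵃ[ℝ] ℝ}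
    (hb : ∀ x ∈ P, b x ≤ lowerEnv P w x) :
    IsExposed ℝ {x ∈ P | a x = lowerEnv P w x}
      ({x ∈ P | a x = lowerEnv P w x} ∩ {x ∈ P | b x = lowerEnv P w x}) := by
  rintro ⟨z, ⟨hzP, hza⟩, -, hzb⟩
  have hd : ∀ y, (b - a).linear y + (b - a) 0 = b y - a y := fun y => by
    have := (b - a).map_vadd 0 y
    simp only [vadd_eq_add, add_zero] at this
    rw [← this]; simp
  refine ⟨LinearMap.toContinuousLinearMap (b - a).linear, ?_⟩
  ext x
  constructor
  · rintro ⟨⟨hxP, hxa⟩, -, hxb⟩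
    refine ⟨⟨hxP, hxa⟩, fun y hy => ?_⟩
    have h1 := hb y hy.1
    have h2 := hy.2
    have h3 := hd y
    have h4 := hd x
    change (b - a).linear y ≤ (b - a).linear x
    linarith
  · rintro ⟨⟨hxP, hxa⟩, hx⟩
    refine ⟨⟨hxP, hxa⟩, hxP, le_antisymm (hb x hxP) ?_⟩
    have h1 : (b - a).linear z ≤ (b - a).linear x := hx z ⟨hzP, hza⟩
    have h3 := hd z
    have h4 := hd x
    linarith

lemma face_cell {n : ℕ} {w : (Fin n → ℤ) → ℝ} {L : Finset (Fin n → ℤ)} {a : Euc n →ᵃ[ℝ] ℝ}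
    (ha : Feas L intPt w a) (G : Set (Euc n))
    (hG : IsExposed ℝ (convexHull ℝ (intPt '' (tight L intPt w a : Set (Fin n → ℤ)))) G)
    (hne : G.Nonempty) :
    ∃ b, Feas L intPt w b ∧
      G = convexHull ℝ (intPt '' (tight L intPt w b : Set (Fin n → ℤ))) := by
  obtain ⟨f, hf⟩ := hG hne
  obtain ⟨z, hz⟩ := hne
  rw [hf] at hz
  obtain ⟨hzT, hzmax⟩ := hz
  let l : Euc n →ᵃ[ℝ] ℝ := (f : Euc n →ₗ[ℝ] ℝ).toAffineMap - AffineMap.const ℝ _ (f z)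
  have hl : ∀ y, l y = f y - f z := fun y => by simp [l]
  obtain ⟨e, he, hee⟩ := exists_small L (fun i => w i - a (intPt i)) (fun i => l (intPt i))
    (fun i hi => sub_nonneg.2 (ha i hi))
  have hb : ∀ y, (a + e • l) y = a y + e * l y := fun y => by simp
  have hlT : ∀ i ∈ tight L intPt w a, l (intPt i) ≤ 0 := fun i hi => by
    have := hzmax (intPt i) (subset_convexHull ℝ _ ⟨i, by exact_mod_cast hi, rfl⟩)
    rw [hl]; linarith
  have htight : tight L intPt w (a + e • l) =
      (tight L intPt w a).filter fun i => -l (intPt i) = 0 := by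
    ext i
    simp only [tight, Finset.mem_filter, hb, neg_eq_zero]
    constructor
    · rintro ⟨hi, h⟩
      by_cases h' : a (intPt i) = w i
      · refine ⟨⟨hi, h'⟩, ?_⟩
        have : e * l (intPt i) = 0 := by linarith
        exact (mul_eq_zero.1 this).resolve_left he.ne'
      · have := hee i hi (sub_ne_zero.2 (Ne.symm h'))
        linarith
    · rintro ⟨⟨hi, h⟩, h'⟩
      exact ⟨hi, by rw [h, h', mul_zero, add_zero]⟩
  refine ⟨a + e • l, ?_, ?_⟩
  · intro i hi
    rw [hb]
    by_cases h : a (intPt i) = w i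
    · have := hlT i (Finset.mem_filter.2 ⟨hi, h⟩)
      nlinarith
    · have := hee i hi (sub_ne_zero.2 (Ne.symm h))
      linarith
  · rw [hf, htight]
    ext x
    constructor
    · rintro ⟨hx, hmax⟩
      obtain ⟨c, hc0, hc1, rfl⟩ := (mem_hull_iff _ _ _).1 hx
      refine mem_hull_tight _ intPt (fun i => -l (intPt i))
        (fun i hi => neg_nonneg.2 (hlT i hi)) c hc0 hc1 ?_
      simp only [mul_neg, Finset.sum_neg_distrib]
      rw [← affine_comb_one _ _ _ _ hc1, hl]
      have h1 := hmax z hzT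
      have h2 := hzmax _ hx
      linarith
    · intro hx
      have hx1 := convexHull_mono (Set.image_mono (Finset.coe_subset.2
        (Finset.filter_subset (fun i => -l (intPt i) = 0) (tight L intPt w a)))) hx
      refine ⟨hx1, fun y hy => (hzmax y hy).trans ?_⟩
      have := affine_le_hull _ _ (-l) 0 (fun i hi => (Finset.mem_filter.1 hi).2.le) hx
      simp only [AffineMap.coe_neg, Pi.neg_apply, hl] at this
      linarith

/-- The relation attached to an arbitrary height function. -/
lemma regular_rel {n : ℕ} {P : Set (Euc n)} (hP : IsLatticePolytope P)
    (w : (Fin n → ℤ) → ℝ) {L : Finset (Fin n → ℤ)}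
    (hL : (L : Set (Fin n → ℤ)) = latticePts P) :
    ∃ cells : Finset (Set (Euc n)), (∀ F, F ∈ cells ↔ F.Nonempty ∧ ∃ a, Feas L intPt w a ∧
      F = convexHull ℝ (intPt '' (tight L intPt w a : Set (Fin n → ℤ)))) ∧
      FreeAbelianGroup.of P - ∑ F ∈ cells,
            (if F ⊆ relBoundary P then 0
             else ((-1 : ℤ) ^ (pdim P - pdim F)) • FreeAbelianGroup.of F)
        ∈ AddSubgroup.closure (relationSet n) := by
  have hfin : {F | IsRegularCell P w F}.Finite := by
    refine (L.powerset.finite_toSet.image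
      fun T : Finset (Fin n → ℤ) => convexHull ℝ (intPt '' (T : Set (Fin n → ℤ)))).subset ?_
    intro F hF
    obtain ⟨_, a, _, rfl⟩ := (regularCell_iff hP hL F).1 hF
    exact ⟨tight L intPt w a, by
      exact_mod_cast Finset.mem_powerset.2 (Finset.filter_subset _ _), rfl⟩
  have hmem : ∀ F, F ∈ hfin.toFinset ↔ F.Nonempty ∧ ∃ a, Feas L intPt w a ∧
      F = convexHull ℝ (intPt '' (tight L intPt w a : Set (Fin n → ℤ))) := fun F => by
    rw [Set.Finite.mem_toFinset]
    exact regularCell_iff hP hL F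
  have hlat : ∀ F ∈ hfin.toFinset, IsLatticePolytope F := fun F hF => by
    obtain ⟨_, a, _, rfl⟩ := (hmem F).1 hF
    exact ⟨_, rfl⟩
  let S : Subdivision P :=
    { cells := hfin.toFinset
      nonempty_cells := fun F hF => ((hmem F).1 hF).1
      poly := fun F hF => by
        obtain ⟨V, rfl⟩ := hlat F hF
        exact ⟨V.image intPt, by rw [Finset.coe_image]⟩
      cover := by
        ext x
        simp only [Set.mem_iUnion, exists_prop]
        constructor
        · rintro ⟨F, hF, hx⟩
          obtain ⟨_, a, _, hF'⟩ := (Set.Finite.mem_toFinset hfin).1 hF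
          rw [hF'] at hx
          exact hx.1
        · intro hx
          rw [hull_latticePts hP, ← hL] at hx
          obtain ⟨a, ha, hxa⟩ := exists_cover L intPt w x hx
          exact ⟨_, (hmem _).2 ⟨⟨x, hxa⟩, a, ha, rfl⟩, hxa⟩
      inter_face := by
        intro F hF G hG
        obtain ⟨_, a, ha, rfl⟩ := (Set.Finite.mem_toFinset hfin).1 hF
        obtain ⟨_, b, hb, rfl⟩ := (Set.Finite.mem_toFinset hfin).1 hG
        refine ⟨cell_exposed hb, ?_⟩
        rw [Set.inter_comm]
        exact cell_exposed ha
      face_mem := by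
        intro F hF G hG hne
        obtain ⟨_, a, ha, rfl⟩ := (hmem F).1 hF
        obtain ⟨b, hb, hGb⟩ := face_cell ha G hG hne
        exact (hmem G).2 ⟨hne, b, hb, hGb⟩ }
  refine ⟨hfin.toFinset, hmem, AddSubgroup.subset_closure (Or.inl ⟨P, S, hP, hlat, ⟨w, ?_⟩, rfl⟩)⟩
  exact hfin.coe_toFinset

/-! ### Affine independence, triangulations and flips -/

def AI {n : ℕ} (T : Finset (Fin n → ℤ)) : Prop :=
  ∀ c : (Fin n → ℤ) → ℝ, ∑ v ∈ T, c v = 0 → ∑ v ∈ T, c v • intPt v = 0 → ∀ v ∈ T, c v = 0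

/-- An affine dependence is also satisfied by the values of an affine function. -/
lemma affine_dep {n : ℕ} (T : Finset (Fin n → ℤ)) (a : Euc n →ᵃ[ℝ] ℝ) (c : (Fin n → ℤ) → ℝ)
    (h0 : ∑ v ∈ T, c v = 0) (h1 : ∑ v ∈ T, c v • intPt v = 0) :
    ∑ v ∈ T, c v * a (intPt v) = 0 := by
  rw [← affine_comb, h0, h1]; ring

lemma generic_heights {n : ℕ} (L : Finset (Fin n → ℤ)) :
    ∃ w : (Fin n → ℤ) → ℝ, ∀ a, AI (tight L intPt w a) := by
  have hdep : ∀ T : Finset (Fin n → ℤ), ∃ c : (Fin n → ℤ) → ℝ, ¬ AI T →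
      ∑ v ∈ T, c v = 0 ∧ ∑ v ∈ T, c v • intPt v = 0 ∧ ∃ v ∈ T, c v ≠ 0 := by
    intro T
    by_cases h : AI T
    · exact ⟨0, fun h' => absurd h h'⟩
    · unfold AI at h
      push Not at h
      obtain ⟨c, h0, h1, v, hv, hne⟩ := h
      exact ⟨c, fun _ => ⟨h0, h1, v, hv, hne⟩⟩
  choose c hc using hdep
  let H : Finset (Fin n → ℤ) → Subspace ℝ ((Fin n → ℤ) → ℝ) := fun T =>
    LinearMap.ker (∑ v ∈ T, c T v • (LinearMap.proj v : ((Fin n → ℤ) → ℝ) →ₗ[ℝ] ℝ))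
  have hH : ∀ T w, w ∈ H T ↔ ∑ v ∈ T, c T v * w v = 0 := fun T w => by
    simp [H, LinearMap.mem_ker]
  let s : Finset (Subspace ℝ ((Fin n → ℤ) → ℝ)) := (L.powerset.filter fun T => ¬ AI T).image H
  have hs : ⊤ ∉ s := by
    intro h
    obtain ⟨T, hT, hTop⟩ := Finset.mem_image.1 h
    obtain ⟨_, _, v, hv, hne⟩ := hc T (Finset.mem_filter.1 hT).2
    have hmem : (Pi.single v 1 : (Fin n → ℤ) → ℝ) ∈ H T := by rw [hTop]; trivial
    rw [hH, Finset.sum_eq_single v] at hmem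
    · simp at hmem
      exact hne hmem
    · intro u _ huv
      simp [huv]
    · intro h; exact absurd hv h
  have hun := Subspace.biUnion_ne_univ_of_top_notMem hs
  obtain ⟨w, hw⟩ := (Set.ne_univ_iff_exists_notMem _).1 hun
  refine ⟨w, fun a => ?_⟩
  by_contra hAI
  obtain ⟨h0, h1, _⟩ := hc _ hAI
  apply hw
  simp only [Set.mem_iUnion]
  refine ⟨H (tight L intPt w a), Finset.mem_image.2 ⟨tight L intPt w a, Finset.mem_filter.2
    ⟨Finset.mem_powerset.2 (Finset.filter_subset _ _), hAI⟩, rfl⟩, ?_⟩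
  rw [SetLike.mem_coe, hH, ← affine_dep _ a _ h0 h1]
  exact Finset.sum_congr rfl fun v hv => by rw [(Finset.mem_filter.1 hv).2]

/-- Every lattice polytope is a combination of lattice simplices. -/
lemma polytope_mem {n : ℕ} (K : AddSubgroup (FreeAbelianGroup (Set (Euc n))))
    (hK : AddSubgroup.closure (relationSet n) ≤ K)
    (hsimp : ∀ T : Finset (Fin n → ℤ), AI T →
      FreeAbelianGroup.of (convexHull ℝ (intPt '' (T : Set (Fin n → ℤ)))) ∈ K)
    {P : Set (Euc n)} (hP : IsLatticePolytope P) : FreeAbelianGroup.of P ∈ K := by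
  have hL : (((latticePts_finite hP).toFinset : Finset (Fin n → ℤ)) : Set (Fin n → ℤ)) =
    latticePts P := Set.Finite.coe_toFinset _
  obtain ⟨w, hw⟩ := generic_heights (latticePts_finite hP).toFinset
  obtain ⟨cells, hcells, hrel⟩ := regular_rel hP w hL
  have h1 := hK hrel
  rw [← sub_add_cancel (FreeAbelianGroup.of P)]
  refine K.add_mem h1 (K.sum_mem fun F hF => ?_)
  obtain ⟨_, a, _, rfl⟩ := (hcells F).1 hF
  split_ifs
  · exact K.zero_mem
  · exact K.zsmul_mem (hsimp _ (hw a)) _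

lemma intrinsicInterior_mono' {n : ℕ} {S P : Set (Euc n)} (h : S ⊆ P)
    (hsp : affineSpan ℝ S = affineSpan ℝ P) :
    intrinsicInterior ℝ S ⊆ intrinsicInterior ℝ P := by
  unfold intrinsicInterior
  rw [hsp]
  exact Set.image_mono (interior_mono (Set.preimage_mono h))

lemma not_subset_relBoundary {n : ℕ} {S P : Set (Euc n)} (h : S ⊆ P)
    (hsp : affineSpan ℝ S = affineSpan ℝ P) (hc : Convex ℝ S) (hne : S.Nonempty) :
    ¬ S ⊆ relBoundary P := by
  intro hb
  obtain ⟨x, hx⟩ := hne.intrinsicInterior hc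
  exact (hb (intrinsicInterior_subset hx)).2 (intrinsicInterior_mono' h hsp hx)

lemma intPt_injective {n : ℕ} : Function.Injective (intPt : (Fin n → ℤ) → Euc n) := by
  intro u v h
  ext i
  have := congrFun h i
  simpa [intPt] using this

lemma pos_of_sum_one {ι : Type*} {S : Finset ι} {l : ι → ℝ} (h : ∑ v ∈ S, l v = 1) :
    S.Nonempty := by
  by_contra h'
  rw [Finset.not_nonempty_iff_eq_empty] at h'
  subst h'
  simp at h

/-- Triangulations of a simplex with one extra point. -/
lemma circuit_rel {n : ℕ} {S : Finset (Fin n → ℤ)} (hS : AI S) {p : Fin n → ℤ} (hp : p ∉ S)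
    (l : (Fin n → ℤ) → ℝ) (hl1 : ∑ v ∈ S, l v = 1) (hlp : ∑ v ∈ S, l v • intPt v = intPt p)
    (e : ℝ) (he : e ≠ 0) (he1 : e ≤ 1) :
    ∃ cells : Finset (Set (Euc n)),
      (∀ F ∈ cells, ∃ T ⊆ insert p S, AI T ∧ (e < 0 → T ≠ S) ∧
        F = convexHull ℝ (intPt '' (T : Set (Fin n → ℤ)))) ∧
      (0 < e → convexHull ℝ (intPt '' (S : Set (Fin n → ℤ))) ∈ cells) ∧
      FreeAbelianGroup.of (convexHull ℝ (intPt '' ((insert p S : Finset (Fin n → ℤ)) :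
          Set (Fin n → ℤ)))) - ∑ F ∈ cells,
            (if F ⊆ relBoundary (convexHull ℝ (intPt '' ((insert p S : Finset (Fin n → ℤ)) :
          Set (Fin n → ℤ)))) then 0
             else ((-1 : ℤ) ^ (pdim (convexHull ℝ (intPt '' ((insert p S : Finset (Fin n → ℤ)) :
          Set (Fin n → ℤ)))) - pdim F)) • FreeAbelianGroup.of F)
        ∈ AddSubgroup.closure (relationSet n) := by
  set P := convexHull ℝ (intPt '' ((insert p S : Finset (Fin n → ℤ)) : Set (Fin n → ℤ))) with hPdef
  have hP : IsLatticePolytope P := ⟨_, rfl⟩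
  set L := (latticePts_finite hP).toFinset with hLdef
  have hL : (L : Set (Fin n → ℤ)) = latticePts P := Set.Finite.coe_toFinset _
  have hWL : ∀ v ∈ insert p S, v ∈ L := fun v hv => by
    rw [hLdef, Set.Finite.mem_toFinset]
    exact subset_convexHull ℝ _ ⟨v, by exact_mod_cast hv, rfl⟩
  let w : (Fin n → ℤ) → ℝ := fun v => if v ∈ S then 0 else if v = p then e else 2
  have hwS : ∀ v ∈ S, w v = 0 := fun v hv => if_pos hv
  have hwp : w p = e := by simp [w, hp]
  have hw2 : ∀ v, v ∉ insert p S → w v = 2 := fun v hv => by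
    rw [Finset.mem_insert, not_or] at hv
    simp [w, hv.1, hv.2]
  have hle : ∀ a, Feas L intPt w a → ∀ x ∈ P, a x ≤ 1 := by
    intro a ha x hx
    refine affine_le_hull (insert p S) intPt a 1 (fun v hv => (ha v (hWL v hv)).trans ?_) hx
    rcases Finset.mem_insert.1 hv with rfl | hv
    · rw [hwp]; exact he1
    · rw [hwS v hv]; norm_num
  have hsub : ∀ a, Feas L intPt w a → tight L intPt w a ⊆ insert p S := by
    intro a ha v hv
    by_contra hcon
    obtain ⟨hvL, hva⟩ := Finset.mem_filter.1 hv
    have hvP : intPt v ∈ P := by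
      rw [hLdef, Set.Finite.mem_toFinset] at hvL
      exact hvL
    have := hle a ha _ hvP
    rw [hva, hw2 v hcon] at this
    norm_num at this
  obtain ⟨cells, hcells, hrel⟩ := regular_rel hP w hL
  refine ⟨cells, fun F hF => ?_, fun hpos => ?_, hrel⟩
  · obtain ⟨_, a, ha, hFa⟩ := (hcells F).1 hF
    refine ⟨_, hsub a ha, ?_, ?_, hFa⟩
    · intro c h0 h1
      have hT := hsub a ha
      set T := tight L intPt w a with hTdef
      have h2 := affine_dep T a c h0 h1
      have h3 : ∀ v ∈ T, v ≠ p → c v * a (intPt v) = 0 := fun v hv hvp => by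
        have hvS : v ∈ S := (Finset.mem_insert.1 (hT hv)).resolve_left hvp
        rw [(Finset.mem_filter.1 hv).2, hwS v hvS, mul_zero]
      have hcp : p ∈ T → c p = 0 := by
        intro hpT
        rw [Finset.sum_eq_single p h3 (fun h => absurd hpT h), (Finset.mem_filter.1 hpT).2, hwp] at h2
        exact (mul_eq_zero.1 h2).resolve_right he
      let d : (Fin n → ℤ) → ℝ := fun v => if v ∈ T then c v else 0
      have hdS : ∀ v, v ∉ S → d v = 0 := by
        intro v hv
        by_cases hvT : v ∈ T
        · have hvp : v = p := (Finset.mem_insert.1 (hT hvT)).resolve_right hv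
          subst hvp
          simp [d, hvT, hcp hvT]
        · simp [d, hvT]
      have hd : ∀ v ∈ T, d v = c v := fun v hv => if_pos hv
      have hdT : ∀ v, v ∉ T → d v = 0 := fun v hv => if_neg hv
      have key := hS d ?_ ?_
      · intro v hv
        by_cases hvS : v ∈ S
        · rw [← hd v hv]; exact key v hvS
        · rw [← hd v hv]; exact hdS v hvS
      · rw [← h0, ← Finset.sum_congr rfl hd,
          Finset.sum_subset (Finset.subset_union_left (s₂ := T)) (fun v _ hv => hdS v hv),
          ← Finset.sum_subset (Finset.subset_union_right (s₁ := S)) (fun v _ hv => hdT v hv)]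
      · have hd' : ∀ v ∈ T, d v • intPt v = c v • intPt v := fun v hv => by rw [hd v hv]
        rw [← h1, ← Finset.sum_congr rfl hd',
          Finset.sum_subset (Finset.subset_union_left (s₂ := T))
            (fun v _ hv => by rw [hdS v hv, zero_smul]),
          ← Finset.sum_subset (Finset.subset_union_right (s₁ := S))
            (fun v _ hv => by rw [hdT v hv, zero_smul])]
    · intro hneg hTS
      have h1 : a (intPt p) = 0 := by
        rw [← hlp, affine_comb_one _ _ _ _ hl1]
        refine Finset.sum_eq_zero fun v hv => ?_
        have hvT := hv
        rw [← hTS] at hvT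
        rw [(Finset.mem_filter.1 hvT).2, hwS v hv, mul_zero]
      have h2 := ha p (hWL p (Finset.mem_insert_self _ _))
      rw [h1, hwp] at h2
      linarith
  · rw [hcells]
    obtain ⟨u, hu⟩ := pos_of_sum_one hl1
    refine ⟨⟨intPt u, subset_convexHull ℝ _ ⟨u, by exact_mod_cast hu, rfl⟩⟩,
      AffineMap.const ℝ _ 0, fun v _ => ?_, ?_⟩
    · simp only [AffineMap.const_apply, w]
      split_ifs
      · exact le_rfl
      · exact hpos.le
      · norm_num
    · have hSt : S = tight L intPt w (AffineMap.const ℝ _ 0) := ?_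
      · rw [← hSt]
      ext v
      constructor
      · intro hv
        exact Finset.mem_filter.2 ⟨hWL v (Finset.mem_insert_of_mem hv), (hwS v hv).symm⟩
      · intro hvt
        have hv : (0 : ℝ) = w v := (Finset.mem_filter.1 hvt).2
        by_contra hvS
        simp only [w, if_neg hvS] at hv
        split_ifs at hv
        · exact hpos.ne hv
        · norm_num at hv

lemma flip_mem {n : ℕ} (K : AddSubgroup (FreeAbelianGroup (Set (Euc n))))
    (hK : AddSubgroup.closure (relationSet n) ≤ K)
    {S : Finset (Fin n → ℤ)} (hS : AI S) {p : Fin n → ℤ} (hp : p ∉ S)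
    (l : (Fin n → ℤ) → ℝ) (hl1 : ∑ v ∈ S, l v = 1) (hlp : ∑ v ∈ S, l v • intPt v = intPt p)
    (hsimp : ∀ T ⊆ insert p S, AI T → T ≠ S →
      FreeAbelianGroup.of (convexHull ℝ (intPt '' (T : Set (Fin n → ℤ)))) ∈ K) :
    FreeAbelianGroup.of (convexHull ℝ (intPt '' (S : Set (Fin n → ℤ)))) ∈ K := by
  set P := convexHull ℝ (intPt '' ((insert p S : Finset (Fin n → ℤ)) : Set (Fin n → ℤ))) with hPdef
  set Q := convexHull ℝ (intPt '' (S : Set (Fin n → ℤ))) with hQdef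
  have hPK : FreeAbelianGroup.of P ∈ K := by
    obtain ⟨cells, hcells, _, hrel⟩ := circuit_rel hS hp l hl1 hlp (-1) (by norm_num) (by norm_num)
    rw [← hPdef] at hrel
    have h1 := hK hrel
    rw [← sub_add_cancel (FreeAbelianGroup.of P)]
    refine K.add_mem h1 (K.sum_mem fun F hF => ?_)
    obtain ⟨T, hT, hAI, hne, rfl⟩ := hcells F hF
    split_ifs
    · exact K.zero_mem
    · exact K.zsmul_mem (hsimp T hT hAI (hne (by norm_num))) _
  obtain ⟨cells, hcells, hQ, hrel⟩ := circuit_rel hS hp l hl1 hlp 1 (by norm_num) (by norm_num)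
  rw [← hPdef] at hrel
  have h1 := hK hrel
  have hQc : Q ∈ cells := hQ one_pos
  rw [← Finset.add_sum_erase _ _ hQc] at h1
  have hQP : Q ⊆ P := convexHull_mono (Set.image_mono (by
    exact_mod_cast Finset.subset_insert p S))
  have hspan : affineSpan ℝ Q = affineSpan ℝ P := by
    rw [hQdef, hPdef, affineSpan_convexHull, affineSpan_convexHull]
    apply le_antisymm
    · exact affineSpan_mono ℝ (Set.image_mono (by exact_mod_cast Finset.subset_insert p S))
    · rw [affineSpan_le]
      rintro _ ⟨v, hv, rfl⟩
      rcases Finset.mem_insert.1 (Finset.mem_coe.1 hv) with rfl | hv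
      · rw [← hlp]
        have h2 := affineCombination_mem_affineSpan (k := ℝ) (s := S.attach)
          (w := fun v => l v.1) (by rw [Finset.sum_attach S l, hl1]) (fun v => intPt v.1)
        rw [Finset.affineCombination_eq_linear_combination _ _ _ (by
          rw [Finset.sum_attach S l, hl1])] at h2
        rw [Finset.sum_attach S (fun v => l v • intPt v)] at h2
        refine affineSpan_mono ℝ ?_ h2
        rintro _ ⟨u, rfl⟩
        exact ⟨u.1, u.2, rfl⟩
      · exact subset_affineSpan ℝ _ ⟨v, hv, rfl⟩
  have hdim : pdim P = pdim Q := by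
    unfold pdim
    rw [← direction_affineSpan, ← direction_affineSpan, hspan]
  have hQne : Q.Nonempty := by
    obtain ⟨u, hu⟩ := pos_of_sum_one hl1
    exact ⟨intPt u, subset_convexHull ℝ _ ⟨u, by exact_mod_cast hu, rfl⟩⟩
  rw [if_neg (not_subset_relBoundary hQP hspan (convex_convexHull ℝ _) hQne), hdim, Nat.sub_self,
    pow_zero, one_zsmul] at h1
  have h3 : ∑ F ∈ cells.erase Q, (if F ⊆ relBoundary P then 0
             else ((-1 : ℤ) ^ (pdim Q - pdim F)) • FreeAbelianGroup.of F) ∈ K := by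
    refine K.sum_mem fun F hF => ?_
    obtain ⟨hFQ, hF⟩ := Finset.mem_erase.1 hF
    obtain ⟨T, hT, hAI, -, rfl⟩ := hcells F hF
    split_ifs
    · exact K.zero_mem
    · refine K.zsmul_mem (hsimp T hT hAI ?_) _
      rintro rfl
      exact hFQ rfl
  have h4 := K.sub_mem (K.sub_mem hPK h1) h3
  convert h4 using 1
  abel

/-! ### Volume of simplices -/

def gram {n N : ℕ} (v : Fin N → Fin n → ℤ) : ℤ :=
  (Matrix.of fun i j => 1 + ∑ t, v i t * v j t).det

/-- Matrix of homogeneous coordinates. -/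
def hmat {n N : ℕ} (v : Fin N → Fin n → ℤ) : Matrix (Fin N) (Option (Fin n)) ℝ :=
  Matrix.of fun i o => o.elim 1 (fun t => (v i t : ℝ))

lemma gram_cast {n N : ℕ} (v : Fin N → Fin n → ℤ) :
    (gram v : ℝ) = (hmat v * (hmat v).transpose).det := by
  unfold gram
  rw [← eq_intCast (Int.castRingHom ℝ), RingHom.map_det]
  congr 1
  ext i j
  simp [hmat, Matrix.mul_apply, Fintype.sum_option]

lemma hmat_update {n N : ℕ} (v : Fin N → Fin n → ℤ) (l : Fin N → ℝ) (p : Fin n → ℤ)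
    (h1 : ∑ i, l i = 1) (hp : ∑ i, l i • intPt (v i) = intPt p) (i : Fin N) :
    hmat (Function.update v i p) = (1 : Matrix (Fin N) (Fin N) ℝ).updateRow i l * hmat v := by
  ext j o
  rw [Matrix.mul_apply]
  by_cases hj : j = i
  · subst hj
    simp only [Matrix.updateRow_self]
    cases o with
    | none => simp [hmat, h1]
    | some t =>
      have := congrFun hp t
      simp only [Finset.sum_apply, Pi.smul_apply, smul_eq_mul, intPt] at this
      simp [hmat, this]
  · rw [Finset.sum_eq_single j]
    · simp [hmat, Function.update_of_ne hj, Matrix.updateRow_ne hj]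
    · intro k _ hk
      simp [Matrix.updateRow_ne hj, Matrix.one_apply_ne (Ne.symm hk)]
    · simp

lemma gram_update {n N : ℕ} (v : Fin N → Fin n → ℤ) (l : Fin N → ℝ) (p : Fin n → ℤ)
    (h1 : ∑ i, l i = 1) (hp : ∑ i, l i • intPt (v i) = intPt p) (i : Fin N) :
    (gram (Function.update v i p) : ℝ) = l i ^ 2 * gram v := by
  rw [gram_cast, gram_cast, hmat_update v l p h1 hp]
  have hC : ((1 : Matrix (Fin N) (Fin N) ℝ).updateRow i l).det = l i := by
    have h := Matrix.det_updateRow_sum (1 : Matrix (Fin N) (Fin N) ℝ) i l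
    have hl : ∑ k, l k • (1 : Matrix (Fin N) (Fin N) ℝ) k = l := by
      ext j
      simp [Finset.sum_apply, Matrix.one_apply]
    rw [hl] at h
    simpa using h
  set C := (1 : Matrix (Fin N) (Fin N) ℝ).updateRow i l
  rw [Matrix.transpose_mul, Matrix.mul_assoc, ← Matrix.mul_assoc (hmat v), ← Matrix.mul_assoc,
    Matrix.det_mul, Matrix.det_mul, Matrix.det_transpose, hC]
  ring

/-- Affine independence of an indexed family. -/
def FI {n N : ℕ} (v : Fin N → Fin n → ℤ) : Prop :=
  ∀ c : Fin N → ℝ, ∑ i, c i = 0 → ∑ i, c i • intPt (v i) = 0 → ∀ i, c i = 0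

lemma gram_ne_zero {n N : ℕ} (v : Fin N → Fin n → ℤ) (hv : FI v) : gram v ≠ 0 := by
  intro h
  have h' : (hmat v * (hmat v).transpose).det = 0 := by rw [← gram_cast, h]; simp
  obtain ⟨c, hc, hcM⟩ := Matrix.exists_vecMul_eq_zero_iff.2 h'
  apply hc
  have h2 : Matrix.vecMul c (hmat v) = 0 := by
    have h3 : Matrix.vecMul c (hmat v) ⬝ᵥ Matrix.vecMul c (hmat v) = 0 := by
      rw [← Matrix.vecMul_vecMul] at hcM
      have : (Matrix.vecMul (Matrix.vecMul c (hmat v)) (hmat v).transpose) ⬝ᵥ c = 0 := by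
        rw [hcM, zero_dotProduct]
      rwa [Matrix.vecMul_transpose, dotProduct_comm, Matrix.dotProduct_mulVec] at this
    exact dotProduct_self_eq_zero.1 h3
  ext i
  refine hv c ?_ ?_ i
  · have := congrFun h2 none
    simpa [Matrix.vecMul, dotProduct, hmat] using this
  · ext t
    have := congrFun h2 (some t)
    simpa [Matrix.vecMul, dotProduct, hmat, intPt] using this

lemma FI.injective {n N : ℕ} {v : Fin N → Fin n → ℤ} (hv : FI v) : Function.Injective v := by
  intro i j hij
  by_contra hne
  have := hv (Pi.single i 1 - Pi.single j 1) (by simp) (by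
    simp [sub_smul, Finset.sum_sub_distrib, Pi.single_apply, ite_smul, hij]) i
  simp [hne] at this

lemma FI_iff_AI {n N : ℕ} {v : Fin N → Fin n → ℤ} (hinj : Function.Injective v) :
    FI v ↔ AI (Finset.univ.image v) := by
  constructor
  · intro h c h0 h1
    rw [Finset.sum_image hinj.injOn] at h0 h1
    have := h (fun i => c (v i)) h0 h1
    intro u hu
    obtain ⟨i, _, rfl⟩ := Finset.mem_image.1 hu
    exact this i
  · intro h c h0 h1 i
    have := h (Function.extend v c 0) (by
      rw [Finset.sum_image hinj.injOn]
      simpa [hinj.extend_apply] using h0) (by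
      rw [Finset.sum_image hinj.injOn]
      simpa [hinj.extend_apply] using h1) (v i) (Finset.mem_image_of_mem _ (Finset.mem_univ _))
    rwa [hinj.extend_apply] at this

/-- From a lattice point with a non-integral barycentric coordinate, find one whose barycentric
coordinates are all of absolute value less than one. -/
lemma exists_reduce {n N : ℕ} (v : Fin N → Fin n → ℤ) (l : Fin N → ℝ) (q : Fin n → ℤ)
    (h1 : ∑ i, l i = 1) (hq : ∑ i, l i • intPt (v i) = intPt q) (j : Fin N)
    (hj : ∀ z : ℤ, l j ≠ z) :
    ∃ (l' : Fin N → ℝ) (p : Fin n → ℤ), ∑ i, l' i = 1 ∧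
      ∑ i, l' i • intPt (v i) = intPt p ∧ ∀ i, |l' i| < 1 := by
  set A := Finset.univ.filter fun i => Int.fract (l i) ≠ 0 with hA
  have hsum : ∑ i, Int.fract (l i) = ((1 - ∑ i, ⌊l i⌋ : ℤ) : ℝ) := by
    simp only [Int.fract, Finset.sum_sub_distrib, h1]
    push_cast
    ring
  have hjA : j ∈ A := by
    rw [hA, Finset.mem_filter]
    refine ⟨Finset.mem_univ _, fun h => hj ⌊l j⌋ ?_⟩
    unfold Int.fract at h
    linarith
  have hsA : ∑ i ∈ A, Int.fract (l i) = ∑ i, Int.fract (l i) :=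
    Finset.sum_filter_ne_zero _
  set s : ℤ := 1 - ∑ i, ⌊l i⌋ with hs
  have hpos : 0 < s := by
    have : (0 : ℝ) < ∑ i ∈ A, Int.fract (l i) := by
      refine Finset.sum_pos (fun i hi => ?_) ⟨j, hjA⟩
      exact lt_of_le_of_ne (Int.fract_nonneg _) (Ne.symm (Finset.mem_filter.1 hi).2)
    rw [hsA, hsum] at this
    exact_mod_cast this
  have hlt : s < A.card := by
    have : ∑ i ∈ A, Int.fract (l i) < ∑ i ∈ A, (1 : ℝ) :=
      Finset.sum_lt_sum_of_nonempty ⟨j, hjA⟩ fun i _ => Int.fract_lt_one _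
    rw [hsA, hsum] at this
    simp only [Finset.sum_const, nsmul_eq_mul, mul_one] at this
    exact_mod_cast this
  obtain ⟨J, hJA, hJ⟩ := Finset.exists_subset_card_eq (s := A) (n := (s - 1).toNat) (by omega)
  have hJ' : (J.card : ℝ) = s - 1 := by
    have : (J.card : ℤ) = s - 1 := by rw [hJ]; omega
    have : ((J.card : ℤ) : ℝ) = ((s - 1 : ℤ) : ℝ) := by rw [this]
    push_cast at this
    exact this
  let z : Fin N → ℤ := fun i => ⌊l i⌋ + if i ∈ J then 1 else 0
  have hz : ∀ i, l i - z i = Int.fract (l i) - if i ∈ J then 1 else 0 := fun i => by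
    simp only [z, Int.fract]
    push_cast
    ring
  refine ⟨fun i => l i - z i, q - ∑ i, z i • v i, ?_, ?_, fun i => ?_⟩
  · simp only [hz, Finset.sum_sub_distrib]
    rw [hsum, Finset.sum_ite_mem, Finset.univ_inter, Finset.sum_const, nsmul_eq_mul, hJ']
    ring
  · simp only [sub_smul, Finset.sum_sub_distrib, hq]
    ext t
    simp [intPt, Finset.sum_apply]
  · dsimp only
    rw [hz, abs_lt]
    have h0 := Int.fract_nonneg (l i)
    have h1 := Int.fract_lt_one (l i)
    split_ifs with h
    · have h2 := lt_of_le_of_ne h0 (Ne.symm (Finset.mem_filter.1 (hJA h)).2)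
      constructor <;> linarith
    · constructor <;> linarith

/-! ### Unimodular simplices -/

lemma exists_basis {n k : ℕ} (b : Fin k → Fin n → ℤ) (hli : LinearIndependent ℤ b)
    (hsat : ∀ (m : ℤ) (z : Fin n → ℤ), m ≠ 0 → m • z ∈ Submodule.span ℤ (Set.range b) →
      z ∈ Submodule.span ℤ (Set.range b)) :
    k ≤ n ∧ ∃ A : Matrix (Fin n) (Fin n) ℤ, IsUnit A.det ∧
      ∀ (j : Fin k) (i t : Fin n), (t : ℕ) = j → A i t = b j i := by
  set W := Submodule.span ℤ (Set.range b) with hW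
  have htf : Module.IsTorsionFree ℤ ((Fin n → ℤ) ⧸ W) := by
    rw [Module.isTorsionFree_iff_smul_eq_zero]
    intro r m hm
    by_cases hr : r = 0
    · exact Or.inl hr
    right
    obtain ⟨z, rfl⟩ := Submodule.Quotient.mk_surjective W m
    rw [← Submodule.Quotient.mk_smul, Submodule.Quotient.mk_eq_zero] at hm
    rw [Submodule.Quotient.mk_eq_zero]
    exact hsat r z hr hm
  let bW : Module.Basis (Fin k) ℤ W := Module.Basis.span hli
  let bQ := Module.Free.chooseBasis ℤ ((Fin n → ℤ) ⧸ W)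
  let B := Module.Basis.sumQuot bW bQ
  have hcard : k + Fintype.card (Module.Free.ChooseBasisIndex ℤ ((Fin n → ℤ) ⧸ W)) = n := by
    have := Module.finrank_eq_card_basis B
    simpa using this.symm
  let e : Fin k ⊕ Module.Free.ChooseBasisIndex ℤ ((Fin n → ℤ) ⧸ W) ≃ Fin n :=
    ((Equiv.refl _).sumCongr (Fintype.equivFin _)).trans
      (finSumFinEquiv.trans (finCongr hcard))
  let B' := B.reindex e
  refine ⟨by omega, (Pi.basisFun ℤ (Fin n)).toMatrix B', ?_, ?_⟩
  · exact Module.Basis.isUnit_det (Pi.basisFun ℤ (Fin n)) B'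
  · intro j i t ht
    have het : e (Sum.inl j) = t := by
      ext
      simp [e, ht]
    rw [Module.Basis.toMatrix_apply, ← het]
    have hb : ((bW j : W) : Fin n → ℤ) = b j :=
      congrArg Subtype.val (Module.Basis.span_apply hli j)
    simp [B', B, hb]

lemma unimod_image {n k : ℕ} (v : Fin (k + 1) → Fin n → ℤ) (A : Matrix (Fin n) (Fin n) ℤ)
    (hk : k ≤ n) (hA : ∀ (j : Fin k) (i t : Fin n), (t : ℕ) = j → A i t = (v j.succ - v 0) i) :
    convexHull ℝ (Set.range fun i => intPt (v i)) = unimodMap A (v 0) '' stdSimplexSet n k := by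
  let f : Euc n →ᵃ[ℝ] Euc n :=
    (Matrix.toLin' (A.map (Int.cast : ℤ → ℝ))).toAffineMap + AffineMap.const ℝ _ (intPt (v 0))
  have hf : ⇑f = unimodMap A (v 0) := by
    ext x
    simp [f, unimodMap]
  rw [← hf, stdSimplexSet, AffineMap.image_convexHull]
  congr 1
  rw [Set.image_insert_eq, ← Set.range_comp, hf]
  have h0 : unimodMap A (v 0) 0 = intPt (v 0) := by simp [unimodMap]
  have hj : ∀ j : Fin k, unimodMap A (v 0) (fun i : Fin n => if (i : ℕ) = (j : ℕ) then (1 : ℝ)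
      else 0) = intPt (v j.succ) := by
    intro j
    ext i
    have hjn : (j : ℕ) < n := lt_of_lt_of_le j.2 hk
    simp only [unimodMap, Pi.add_apply, Matrix.mulVec, dotProduct, Matrix.map_apply]
    rw [Finset.sum_eq_single (⟨j, hjn⟩ : Fin n)]
    · rw [hA j i ⟨j, hjn⟩ rfl]
      simp [intPt]
    · intro t _ ht
      have : (t : ℕ) ≠ j := fun h => ht (Fin.ext h)
      simp [this]
    · simp
  rw [h0]
  ext x
  simp only [Set.mem_range, Set.mem_insert_iff, Function.comp_apply, hj, Fin.exists_fin_succ]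
  tauto

lemma simplex_unimodular {n k : ℕ} (v : Fin (k + 1) → Fin n → ℤ) (hv : FI v)
    (hinteg : ∀ (l : Fin (k + 1) → ℝ) (q : Fin n → ℤ), ∑ i, l i = 1 →
      ∑ i, l i • intPt (v i) = intPt q → ∀ j, ∃ z : ℤ, l j = z) :
    IsUnimodularSimplex (convexHull ℝ (Set.range fun i => intPt (v i))) := by
  have hdep : ∀ (c : Fin k → ℝ) (x : Euc n), ∑ j, c j • (intPt (v j.succ) - intPt (v 0)) = x →
      ∑ i, (Fin.cons (- ∑ j, c j) c : Fin (k + 1) → ℝ) i • intPt (v i) = x := by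
    intro c x h
    rw [← h, Fin.sum_univ_succ]
    simp only [Fin.cons_zero, Fin.cons_succ, smul_sub, Finset.sum_sub_distrib, neg_smul,
      Finset.sum_smul]
    abel
  have hcast : ∀ (c : Fin k → ℤ) (z : Fin n → ℤ), ∑ j, c j • (v j.succ - v 0) = z →
      ∑ j, (c j : ℝ) • (intPt (v j.succ) - intPt (v 0)) = intPt z := by
    intro c z h
    rw [← h]
    ext t
    simp [intPt, Finset.sum_apply]
  have hli : LinearIndependent ℤ (fun j : Fin k => v j.succ - v 0) := by
    rw [Fintype.linearIndependent_iff]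
    intro c hc j
    have h1 := hdep (fun j => (c j : ℝ)) _ (hcast c 0 hc)
    have h2 := hv _ (by rw [Fin.sum_univ_succ]; simp) (h1.trans (by ext; simp [intPt])) j.succ
    simpa using h2
  obtain ⟨hk, A, hA, hAb⟩ := exists_basis (fun j : Fin k => v j.succ - v 0) hli (by
    intro m z hm hz
    obtain ⟨c, hc⟩ := (Submodule.mem_span_range_iff_exists_fun ℤ).1 hz
    have h1 := hcast c _ hc
    have hm' : (m : ℝ) ≠ 0 := by exact_mod_cast hm
    have h2 : ∑ j, ((c j : ℝ) / m) • (intPt (v j.succ) - intPt (v 0)) = intPt z := by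
      have h3 : ∑ j, ((c j : ℝ) / m) • (intPt (v j.succ) - intPt (v 0)) =
          (m : ℝ)⁻¹ • ∑ j, (c j : ℝ) • (intPt (v j.succ) - intPt (v 0)) := by
        rw [Finset.smul_sum]
        exact Finset.sum_congr rfl fun j _ => by rw [smul_smul]; congr 1; ring
      rw [h3, h1]
      ext t
      simp [intPt, hm']
    have h4 := hdep _ _ h2
    set d : Fin (k + 1) → ℝ := Fin.cons (- ∑ j, (c j : ℝ) / m) (fun j => (c j : ℝ) / m) with hd
    have h5 := hinteg (d + Pi.single 0 1) (z + v 0) (by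
      simp only [Pi.add_apply, Finset.sum_add_distrib]
      rw [Fin.sum_univ_succ]
      simp [hd]) (by
      simp only [Pi.add_apply, add_smul, Finset.sum_add_distrib]
      rw [h4]
      ext t
      simp [intPt, Pi.single_apply, ite_smul])
    choose y hy using fun j : Fin k => h5 j.succ
    rw [Submodule.mem_span_range_iff_exists_fun]
    refine ⟨y, ?_⟩
    apply intPt_injective
    rw [← h2, ← hcast y _ rfl]
    refine Finset.sum_congr rfl fun j _ => ?_
    rw [← hy j]
    simp [hd])
  exact ⟨k, hk, A, hA, v 0, unimod_image v A hk hAb⟩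

/-! ### The main induction -/

lemma simplex_mem {n : ℕ} (K : AddSubgroup (FreeAbelianGroup (Set (Euc n))))
    (hK : AddSubgroup.closure (relationSet n) ≤ K)
    (hU : ∀ Q : Set (Euc n), IsUnimodularSimplex Q → FreeAbelianGroup.of Q ∈ K) (N : ℕ) :
    ∀ (m : ℕ) (v : Fin N → Fin n → ℤ), FI v → (gram v).natAbs = m →
      FreeAbelianGroup.of (convexHull ℝ (Set.range fun i => intPt (v i))) ∈ K := by
  induction N using Nat.strong_induction_on with
  | _ N ihN =>
  intro m
  induction m using Nat.strong_induction_on with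
  | _ m ihm =>
  intro v hv hm
  have himg : ∀ {N' : ℕ} (u : Fin N' → Fin n → ℤ), (Set.range fun i => intPt (u i)) =
      intPt '' ((Finset.univ.image u : Finset (Fin n → ℤ)) : Set (Fin n → ℤ)) := by
    intro N' u
    rw [Finset.coe_image, Finset.coe_univ, Set.image_univ, ← Set.range_comp]
    rfl
  by_cases hinteg : ∀ (l : Fin N → ℝ) (q : Fin n → ℤ), ∑ i, l i = 1 →
      ∑ i, l i • intPt (v i) = intPt q → ∀ j, ∃ z : ℤ, l j = z
  · cases N with
    | zero =>
      have : (Set.range fun i => intPt (v i)) = ∅ := Set.range_eq_empty _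
      rw [this, convexHull_empty]
      exact hK (AddSubgroup.subset_closure (Or.inr (Or.inl rfl)))
    | succ k => exact hU _ (simplex_unimodular v hv hinteg)
  push Not at hinteg
  obtain ⟨l0, q, hl0, hq, j, hj⟩ := hinteg
  obtain ⟨l, p, hl1, hlp, habs⟩ := exists_reduce v l0 q hl0 hq j hj
  have hinj := hv.injective
  have hp : p ∉ Finset.univ.image v := by
    intro hp
    obtain ⟨i, _, rfl⟩ := Finset.mem_image.1 hp
    have := hv (l - Pi.single i 1) (by simp [hl1]) (by
      simp [sub_smul, Finset.sum_sub_distrib, hlp, Pi.single_apply, ite_smul]) i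
    simp only [Pi.sub_apply, Pi.single_eq_same] at this
    have h2 := (abs_lt.1 (habs i)).2
    linarith
  set S := Finset.univ.image v with hSdef
  have hScard : S.card = N := by
    rw [hSdef, Finset.card_image_of_injective _ hinj, Finset.card_fin]
  have hSAI : AI S := (FI_iff_AI hinj).1 hv
  have hE : ∀ i, Function.extend v l 0 (v i) = l i := fun i => hinj.extend_apply _ _ _
  have hs1 : ∑ u ∈ S, Function.extend v l 0 u = 1 := by
    rw [hSdef, Finset.sum_image hinj.injOn]
    simpa [hE] using hl1
  have hs2 : ∑ u ∈ S, Function.extend v l 0 u • intPt u = intPt p := by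
    rw [hSdef, Finset.sum_image hinj.injOn]
    simpa [hE] using hlp
  rw [himg]
  refine flip_mem K hK hSAI hp (Function.extend v l 0) hs1 hs2 ?_
  intro T hT hTAI hTS
  have hTW : T ≠ insert p S := by
    rintro rfl
    have := hTAI (fun u => if u = p then -1 else Function.extend v l 0 u) ?_ ?_ p
      (Finset.mem_insert_self _ _)
    · simp at this
    · rw [Finset.sum_insert hp, if_pos rfl, Finset.sum_congr rfl
        (fun u hu => if_neg (fun h : u = p => hp (h ▸ hu))), hs1]
      norm_num
    · rw [Finset.sum_insert hp, if_pos rfl, Finset.sum_congr rfl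
        (fun u hu => by rw [if_neg (fun h : u = p => hp (h ▸ hu))] :
          ∀ u ∈ S, (if u = p then -1 else Function.extend v l 0 u) • intPt u =
            Function.extend v l 0 u • intPt u), hs2]
      simp
  have hTlt : T.card < N + 1 := by
    rw [← hScard, ← Finset.card_insert_of_notMem hp]
    exact Finset.card_lt_card (lt_of_le_of_ne hT hTW)
  rcases Nat.lt_or_ge T.card N with hlt | hge
  · let u : Fin T.card → Fin n → ℤ := fun i => (T.equivFin.symm i).1
    have huinj : Function.Injective u := Subtype.val_injective.comp T.equivFin.symm.injective
    have hu : Finset.univ.image u = T := by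
      ext x
      simp only [Finset.mem_image, Finset.mem_univ, true_and]
      constructor
      · rintro ⟨i, rfl⟩
        exact (T.equivFin.symm i).2
      · intro hx
        exact ⟨T.equivFin ⟨x, hx⟩, by simp [u]⟩
    have := ihN T.card hlt _ u ((FI_iff_AI huinj).2 (by rwa [hu])) rfl
    rwa [himg, hu] at this
  · obtain ⟨x, hxW, hxT⟩ : ∃ x ∈ insert p S, x ∉ T := by
      by_contra hcon
      push Not at hcon
      exact hTW (Finset.Subset.antisymm hT hcon)
    have hTe : T = (insert p S).erase x := by
      apply Finset.eq_of_subset_of_card_le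
      · intro y hy
        exact Finset.mem_erase.2 ⟨fun h => hxT (h ▸ hy), hT hy⟩
      · rw [Finset.card_erase_of_mem hxW, Finset.card_insert_of_notMem hp, hScard]
        omega
    have hxp : x ≠ p := by
      rintro rfl
      exact hTS (by rw [hTe, Finset.erase_insert hp])
    have hxS : x ∈ S := (Finset.mem_insert.1 hxW).resolve_left hxp
    obtain ⟨i, _, rfl⟩ := Finset.mem_image.1 hxS
    have hpv : ∀ j, v j ≠ p := fun j h =>
      hp (h ▸ Finset.mem_image_of_mem v (Finset.mem_univ j))
    have huT : Finset.univ.image (Function.update v i p) = T := by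
      rw [hTe]
      ext y
      simp only [Finset.mem_image, Finset.mem_univ, true_and, Finset.mem_erase, Finset.mem_insert,
        hSdef]
      constructor
      · rintro ⟨j, rfl⟩
        by_cases hji : j = i
        · subst hji
          rw [Function.update_self]
          exact ⟨(hpv j).symm, Or.inl rfl⟩
        · rw [Function.update_of_ne hji]
          exact ⟨fun h => hji (hinj h), Or.inr ⟨j, rfl⟩⟩
      · rintro ⟨hyi, rfl | ⟨j, rfl⟩⟩
        · exact ⟨i, Function.update_self _ _ _⟩
        · exact ⟨j, Function.update_of_ne (fun h => hyi (by rw [h])) _ _⟩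
    have huinj : Function.Injective (Function.update v i p) := by
      intro a b hab
      by_cases ha : a = i <;> by_cases hb : b = i
      · rw [ha, hb]
      · subst ha
        rw [Function.update_self, Function.update_of_ne hb] at hab
        exact absurd hab.symm (hpv b)
      · subst hb
        rw [Function.update_self, Function.update_of_ne ha] at hab
        exact absurd hab (hpv a)
      · rw [Function.update_of_ne ha, Function.update_of_ne hb] at hab
        exact hinj hab
    have hgram : (gram (Function.update v i p)).natAbs < m := by
      rw [← hm]
      have h1 := gram_update v l p hl1 hlp i
      have h2 : (0 : ℝ) < |(gram v : ℝ)| := by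
        rw [abs_pos]
        exact_mod_cast gram_ne_zero v hv
      have h3 : |(gram (Function.update v i p) : ℝ)| < |(gram v : ℝ)| := by
        rw [h1, abs_mul, abs_pow]
        have h4 : |l i| ^ 2 < 1 := by
          have := habs i
          have := abs_nonneg (l i)
          nlinarith
        nlinarith
      have h5 : |gram (Function.update v i p)| < |gram v| := by exact_mod_cast h3
      rw [Int.abs_eq_natAbs, Int.abs_eq_natAbs] at h5
      exact_mod_cast h5
    have := ihm _ hgram (Function.update v i p) ((FI_iff_AI huinj).2 (by rwa [huT])) rfl
    rwa [himg, huT] at this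

lemma AI_mem {n : ℕ} (K : AddSubgroup (FreeAbelianGroup (Set (Euc n))))
    (hK : AddSubgroup.closure (relationSet n) ≤ K)
    (hU : ∀ Q : Set (Euc n), IsUnimodularSimplex Q → FreeAbelianGroup.of Q ∈ K)
    (T : Finset (Fin n → ℤ)) (hTAI : AI T) :
    FreeAbelianGroup.of (convexHull ℝ (intPt '' (T : Set (Fin n → ℤ)))) ∈ K := by
  let u : Fin T.card → Fin n → ℤ := fun i => (T.equivFin.symm i).1
  have huinj : Function.Injective u := Subtype.val_injective.comp T.equivFin.symm.injective
  have hu : Finset.univ.image u = T := by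
    ext x
    simp only [Finset.mem_image, Finset.mem_univ, true_and]
    constructor
    · rintro ⟨i, rfl⟩
      exact (T.equivFin.symm i).2
    · intro hx
      exact ⟨T.equivFin ⟨x, hx⟩, by simp [u]⟩
  have := simplex_mem K hK hU T.card _ u ((FI_iff_AI huinj).2 (by rwa [hu])) rfl
  have himg : (Set.range fun i => intPt (u i)) = intPt '' (T : Set (Fin n → ℤ)) := by
    have hu' : (T : Set (Fin n → ℤ)) = Set.range u := by
      conv_lhs => rw [← hu]
      rw [Finset.coe_image, Finset.coe_univ, Set.image_univ]
    rw [hu', ← Set.range_comp]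
    rfl
  rwa [himg] at this

lemma closure_unimod {n : ℕ} (y : FreeAbelianGroup (Set (Euc n)))
    (hy : y ∈ AddSubgroup.closure
      (FreeAbelianGroup.of '' {Q : Set (Euc n) | IsUnimodularSimplex Q})) :
    ∃ c : Set (Euc n) →₀ ℤ, (∀ Q ∈ c.support, IsUnimodularSimplex Q) ∧
      y = c.sum (fun Q m => m • FreeAbelianGroup.of Q) := by
  induction hy using AddSubgroup.closure_induction with
  | mem x hx =>
    obtain ⟨Q, hQ, rfl⟩ := hx
    refine ⟨Finsupp.single Q 1, fun R hR => ?_, ?_⟩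
    · rw [Finset.mem_singleton.1 (Finsupp.support_single_subset hR)]
      exact hQ
    · rw [Finsupp.sum_single_index] <;> simp
  | zero => exact ⟨0, by simp, by simp⟩
  | add x y _ _ hx hy =>
    obtain ⟨c, hc, rfl⟩ := hx
    obtain ⟨d, hd, rfl⟩ := hy
    refine ⟨c + d, fun Q hQ => ?_, ?_⟩
    · rcases Finset.mem_union.1 (Finsupp.support_add hQ) with h | h
      · exact hc Q h
      · exact hd Q h
    · rw [Finsupp.sum_add_index'] <;> simp [add_smul]
  | neg x _ hx =>
    obtain ⟨c, hc, rfl⟩ := hx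
    refine ⟨-c, fun Q hQ => hc Q (by rwa [Finsupp.support_neg] at hQ), ?_⟩
    rw [Finsupp.sum_neg_index] <;> simp [Finsupp.sum]

theorem statement5 {n : ℕ} (P : Set (Euc n)) (hP : IsLatticePolytope P) :
    ∃ c : Set (Euc n) →₀ ℤ,
      (∀ Q ∈ c.support, IsUnimodularSimplex Q) ∧
      FreeAbelianGroup.of P - c.sum (fun Q m => m • FreeAbelianGroup.of Q)
        ∈ AddSubgroup.closure (relationSet n) := by
  let U := AddSubgroup.closure
    (FreeAbelianGroup.of '' {Q : Set (Euc n) | IsUnimodularSimplex Q})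
  let K := AddSubgroup.closure (relationSet n) ⊔ U
  have hK : AddSubgroup.closure (relationSet n) ≤ K := le_sup_left
  have hU : ∀ Q : Set (Euc n), IsUnimodularSimplex Q → FreeAbelianGroup.of Q ∈ K := fun Q hQ =>
    (le_sup_right : U ≤ K) (AddSubgroup.subset_closure ⟨Q, hQ, rfl⟩)
  have hmem : FreeAbelianGroup.of P ∈ K := polytope_mem K hK (AI_mem K hK hU) hP
  obtain ⟨x, hx, y, hy, hxy⟩ := AddSubgroup.mem_sup.1 hmem
  obtain ⟨c, hc, rfl⟩ := closure_unimod y hy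
  refine ⟨c, hc, ?_⟩
  rw [← hxy, add_sub_cancel_right]
  exact hx
end
end

section
/- The face poset of a convex polytope P (including the empty face and P itself) is an Eulerian poset, with rank function ρ(Q) = dim Q + 1. -/
open Classical Polynomial
noncomputable section

/-- The rank of a face in the face poset: dim Q + 1, with the empty face having rank 0. -/
def faceRank {n : ℕ} (Q : Set (Euc n)) : ℕ := if Q = ∅ then 0 else pdim Q + 1

/-! ### Linear algebra and sign-vector lemmas -/

lemma perturb_sign {κ : Type*} [Finite κ] (a b : κ → ℝ) :
    ∃ ε : ℝ, 0 < ε ∧ ∀ i, a i ≠ 0 →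
      SignType.sign (a i + ε * b i) = SignType.sign (a i) ∧
      SignType.sign (a i + (-ε) * b i) = SignType.sign (a i) := by
  have h : ∀ᶠ ε in nhdsWithin (0:ℝ) (Set.Ioi 0), ∀ i, a i ≠ 0 → |ε * b i| < |a i| := by
    rw [Filter.eventually_all]
    intro i
    by_cases h0 : a i = 0
    · exact Filter.Eventually.of_forall (fun _ h => absurd h0 h)
    · have hc : Continuous (fun ε : ℝ => |ε * b i|) := by fun_prop
      have ht := hc.tendsto 0
      have : ∀ᶠ ε in nhds (0:ℝ), |ε * b i| < |a i| := by
        apply ht.eventually_lt_const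
        simpa using h0
      exact (this.filter_mono nhdsWithin_le_nhds).mono (fun _ h _ => h)
  obtain ⟨ε, h1, h2⟩ := (h.and self_mem_nhdsWithin).exists
  refine ⟨ε, h2, fun i hi => ?_⟩
  have h3 := h1 i hi
  rw [abs_lt] at h3
  rcases lt_or_gt_of_ne hi with hlt | hgt
  · rw [abs_of_neg hlt] at h3
    rw [sign_neg hlt, sign_neg (by linarith), sign_neg (by linarith)]
    simp
  · rw [abs_of_pos hgt] at h3
    rw [sign_pos hgt, sign_pos (by linarith), sign_pos (by linarith)]
    simp

set_option linter.unusedSectionVars false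

section LA
variable {E : Type*} [AddCommGroup E] [Module ℝ E] [FiniteDimensional ℝ E]

lemma finrank_sup_singleton (Z : Submodule ℝ E) (w : E) (hw : w ∉ Z) :
    Module.finrank ℝ (Z ⊔ Submodule.span ℝ {w} : Submodule ℝ E) = Module.finrank ℝ Z + 1 := by
  have hw0 : w ≠ 0 := fun h => hw (h ▸ Z.zero_mem)
  have h := Submodule.finrank_sup_add_finrank_inf_eq Z (Submodule.span ℝ {w})
  have hd : Disjoint Z (Submodule.span ℝ {w}) := by
    rw [Submodule.disjoint_span_singleton' hw0]
    exact hw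
  rw [hd.eq_bot, finrank_bot, finrank_span_singleton hw0] at h
  simpa using h

lemma exists_dual_sep (Z : Submodule ℝ E) (w : E) (hw : w ∉ Z) :
    ∃ l : E →ₗ[ℝ] ℝ, (∀ z ∈ Z, l z = 0) ∧ l w = 1 := by
  obtain ⟨f, hf, hZ⟩ := Submodule.exists_le_ker_of_notMem hw
  refine ⟨(f w)⁻¹ • f, fun z hz => ?_, ?_⟩
  · have : f z = 0 := hZ hz
    simp [this]
  · simp [hf]

variable {κ : Type*} [Fintype κ]

/-- the sign vector of a functional on the sub-family `A` (filled up with `1`). -/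
def sgv (u : κ → E) (A : Finset κ) (l : E →ₗ[ℝ] ℝ) : κ → SignType :=
  fun i => if i ∈ A then SignType.sign (l (u i)) else 1

def cells (u : κ → E) (A : Finset κ) : Finset (κ → SignType) :=
  Finset.univ.filter (fun σ => ∃ l, sgv u A l = σ)

def zsp (u : κ → E) (σ : κ → SignType) : Submodule ℝ E :=
  Submodule.span ℝ (u '' {i | σ i = 0})

def wt (u : κ → E) (σ : κ → SignType) : ℤ := (-1) ^ (Module.finrank ℝ (zsp u σ))

lemma mem_cells {u : κ → E} {A : Finset κ} {σ : κ → SignType} :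
    σ ∈ cells u A ↔ ∃ l, sgv u A l = σ := by simp [cells]

lemma zsp_update_ne (u : κ → E) (σ : κ → SignType) (a : κ) (ha : σ a = 1) (s : SignType)
    (hs : s ≠ 0) : zsp u (Function.update σ a s) = zsp u σ := by
  unfold zsp
  congr 2
  ext i
  by_cases h : i = a
  · subst h; simp [hs, ha]
  · simp [h]

lemma zsp_update_zero (u : κ → E) (σ : κ → SignType) (a : κ) (ha : σ a = 1) :
    zsp u (Function.update σ a 0) = zsp u σ ⊔ Submodule.span ℝ {u a} := by
  unfold zsp
  rw [← Submodule.span_union]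
  congr 1
  have : {i | Function.update σ a 0 i = 0} = {i | σ i = 0} ∪ {a} := by
    ext i
    by_cases h : i = a
    · subst h; simp
    · simp [h]
  rw [this, Set.image_union, Set.image_singleton]

lemma update_sgv (u : κ → E) (A : Finset κ) (a : κ) (ha : a ∉ A) (l : E →ₗ[ℝ] ℝ) :
    Function.update (sgv u (insert a A) l) a 1 = sgv u A l := by
  ext i
  by_cases h : i = a
  · subst h; simp [sgv, ha]
  · simp [sgv, h]

lemma sgv_insert (u : κ → E) (A : Finset κ) (a : κ) (l : E →ₗ[ℝ] ℝ) :
    sgv u (insert a A) l = Function.update (sgv u A l) a (SignType.sign (l (u a))) := by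
  ext i
  by_cases h : i = a
  · subst h; simp [sgv]
  · simp [sgv, h]

lemma update_mem_cells (u : κ → E) (A : Finset κ) (a : κ) (ha : a ∉ A) (σ : κ → SignType)
    (hσ : σ a = 1) (s : SignType) :
    Function.update σ a s ∈ cells u (insert a A) ↔
      ∃ l, sgv u A l = σ ∧ SignType.sign (l (u a)) = s := by
  rw [mem_cells]
  constructor
  · rintro ⟨l, hl⟩
    refine ⟨l, ?_, ?_⟩
    · rw [← update_sgv u A a ha, hl]
      simp [← hσ]
    · have := congrFun hl a
      simpa [sgv] using this
  · rintro ⟨l, h1, h2⟩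
    exact ⟨l, by rw [sgv_insert, h1, h2]⟩

lemma sgv_eq_iff (u : κ → E) (A : Finset κ) (l l' : E →ₗ[ℝ] ℝ) :
    sgv u A l = sgv u A l' ↔ ∀ i ∈ A, SignType.sign (l (u i)) = SignType.sign (l' (u i)) := by
  constructor
  · intro h i hi
    have := congrFun h i
    simpa [sgv, hi] using this
  · intro h
    ext i
    by_cases hi : i ∈ A
    · simp [sgv, hi, h i hi]
    · simp [sgv, hi]

lemma fiber_sum (u : κ → E) (A : Finset κ) (a : κ) (ha : a ∉ A) (σ : κ → SignType)
    (hσ : σ ∈ cells u A) :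
    ∑ s : SignType, (if Function.update σ a s ∈ cells u (insert a A)
      then wt u (Function.update σ a s) else 0) = wt u σ := by
  obtain ⟨l, rfl⟩ := mem_cells.1 hσ
  have h1 : sgv u A l a = 1 := by simp [sgv, ha]
  set σ := sgv u A l with hσdef
  have hwp : wt u (Function.update σ a 1) = wt u σ := by
    rw [wt, zsp_update_ne u σ a h1 1 (by decide), wt]
  have hwn : wt u (Function.update σ a (-1)) = wt u σ := by
    rw [wt, zsp_update_ne u σ a h1 (-1) (by decide), wt]
  have hsum : ∀ f : SignType → ℤ, ∑ s, f s = f 0 + f (-1) + f 1 := by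
    intro f
    have : (Finset.univ : Finset SignType) = {0, -1, 1} := by decide
    rw [this, Finset.sum_insert (by decide), Finset.sum_insert (by decide),
      Finset.sum_singleton, add_assoc]
  rw [hsum]
  simp only [update_mem_cells u A a ha σ h1, hwp, hwn]
  by_cases hw : u a ∈ zsp u σ
  · -- only zero
    have hz : ∀ l', sgv u A l' = σ → l' (u a) = 0 := by
      intro l' hl'
      have : zsp u σ ≤ LinearMap.ker l' := by
        rw [zsp, Submodule.span_le]
        rintro _ ⟨i, hi, rfl⟩
        have hi' : σ i = 0 := hi
        have hiA : i ∈ A := by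
          by_contra hA
          rw [← hl'] at hi'
          simp [sgv, hA] at hi'
        rw [← hl'] at hi'
        simp only [sgv, hiA, if_true, sign_eq_zero_iff] at hi'
        exact hi'
      exact this hw
    have h0 : wt u (Function.update σ a 0) = wt u σ := by
      rw [wt, zsp_update_zero u σ a h1, wt]
      rw [sup_eq_left.2]
      rw [Submodule.span_le]
      simpa using hw
    rw [if_pos ⟨l, rfl, by rw [hz l rfl, sign_zero]⟩, if_neg, if_neg, h0]
    · ring
    · rintro ⟨l', h, h'⟩
      rw [hz l' h] at h'
      simp at h'
    · rintro ⟨l', h, h'⟩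
      rw [hz l' h] at h'
      simp at h'
  · have h0 : wt u (Function.update σ a 0) = - wt u σ := by
      rw [wt, zsp_update_zero u σ a h1, wt, finrank_sup_singleton _ _ hw, pow_succ]
      ring
    rw [h0]
    by_cases hex : ∃ l', sgv u A l' = σ ∧ l' (u a) = 0
    · obtain ⟨l₁, hl₁, hl₁a⟩ := hex
      obtain ⟨m, hm, hm1⟩ := exists_dual_sep _ _ hw
      obtain ⟨ε, hε, hs⟩ := perturb_sign (fun i => l₁ (u i)) (fun i => m (u i))
      have hmz : ∀ i ∈ A, l₁ (u i) = 0 → m (u i) = 0 := by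
        intro i hi h
        apply hm
        apply Submodule.subset_span
        refine ⟨i, ?_, rfl⟩
        rw [← hl₁]
        simp [sgv, hi, h]
      have hp : sgv u A (l₁ + ε • m) = σ := by
        rw [← hl₁, sgv_eq_iff]
        intro i hi
        by_cases h : l₁ (u i) = 0
        · simp [h, hmz i hi h]
        · simpa using (hs i h).1
      have hn : sgv u A (l₁ + (-ε) • m) = σ := by
        rw [← hl₁, sgv_eq_iff]
        intro i hi
        by_cases h : l₁ (u i) = 0
        · simp [h, hmz i hi h]
        · simpa using (hs i h).2
      rw [if_pos ⟨l₁, hl₁, by rw [hl₁a, sign_zero]⟩,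
        if_pos ⟨_, hn, by simp [hl₁a, hm1, hε]⟩,
        if_pos ⟨_, hp, by simp [hl₁a, hm1, hε]⟩]
      ring
    · rw [if_neg (by
        rintro ⟨l', h, h'⟩
        exact hex ⟨l', h, sign_eq_zero_iff.1 h'⟩)]
      have hnot : ¬ ((∃ l', sgv u A l' = σ ∧ SignType.sign (l' (u a)) = -1) ∧
          (∃ l', sgv u A l' = σ ∧ SignType.sign (l' (u a)) = 1)) := by
        rintro ⟨⟨l₁, h₁, s₁⟩, ⟨l₂, h₂, s₂⟩⟩
        rw [sign_eq_neg_one_iff] at s₁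
        rw [sign_eq_one_iff] at s₂
        apply hex
        refine ⟨(l₂ (u a)) • l₁ + (- l₁ (u a)) • l₂, ?_, ?_⟩
        · rw [← h₁, sgv_eq_iff]
          intro i hi
          have h12 := (sgv_eq_iff u A l₁ l₂).1 (h₁.trans h₂.symm) i hi
          simp only [LinearMap.add_apply, LinearMap.smul_apply, smul_eq_mul]
          rcases lt_trichotomy (l₁ (u i)) 0 with h | h | h
          · rw [sign_neg h] at h12 ⊢
            have := sign_eq_neg_one_iff.1 h12.symm
            rw [sign_neg]
            nlinarith [mul_pos s₂ (neg_pos.2 h), mul_pos (neg_pos.2 s₁) (neg_pos.2 this)]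
          · rw [h, sign_zero] at h12
            have := sign_eq_zero_iff.1 h12.symm
            simp [h, this]
          · rw [sign_pos h] at h12 ⊢
            have := sign_eq_one_iff.1 h12.symm
            rw [sign_pos]
            nlinarith [mul_pos s₂ h, mul_pos (neg_pos.2 s₁) this]
        · simp; ring
      have hor : (∃ l', sgv u A l' = σ ∧ SignType.sign (l' (u a)) = -1) ∨
          (∃ l', sgv u A l' = σ ∧ SignType.sign (l' (u a)) = 1) := by
        rcases lt_trichotomy (l (u a)) 0 with h | h | h
        · exact Or.inl ⟨l, rfl, sign_neg h⟩
        · exact absurd ⟨l, rfl, h⟩ hex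
        · exact Or.inr ⟨l, rfl, sign_pos h⟩
      rcases hor with h | h
      · rw [if_pos h, if_neg (fun h' => hnot ⟨h, h'⟩)]; ring
      · rw [if_pos h, if_neg (fun h' => hnot ⟨h', h⟩)]; ring

lemma refine_one (u : κ → E) (A : Finset κ) (a : κ) (ha : a ∉ A) (R : (κ → SignType) → Prop)
    (hR : ∀ σ τ, (∀ i ∈ A, σ i = τ i) → R σ → R τ) :
    ∑ σ ∈ (cells u (insert a A)).filter R, wt u σ = ∑ σ ∈ (cells u A).filter R, wt u σ := by
  have hmap : ∀ σ ∈ (cells u (insert a A)).filter R,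
      Function.update σ a 1 ∈ (cells u A).filter R := by
    intro σ hσ
    rw [Finset.mem_filter, mem_cells] at hσ ⊢
    obtain ⟨⟨l, rfl⟩, hr⟩ := hσ
    refine ⟨⟨l, (update_sgv u A a ha l).symm⟩, hR _ _ ?_ hr⟩
    intro i hi
    have : i ≠ a := fun h => ha (h ▸ hi)
    simp [this]
  rw [← Finset.sum_fiberwise_of_maps_to hmap]
  apply Finset.sum_congr rfl
  intro σ hσ
  rw [Finset.mem_filter] at hσ
  rw [← fiber_sum u A a ha σ hσ.1, ← Finset.sum_filter]
  have h1 : σ a = 1 := by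
    obtain ⟨l, rfl⟩ := mem_cells.1 hσ.1
    simp [sgv, ha]
  symm
  apply Finset.sum_bij (fun s _ => Function.update σ a s)
  · intro s hs
    simp only [Finset.mem_filter, Finset.mem_univ, true_and] at hs ⊢
    refine ⟨⟨hs, hR _ _ ?_ hσ.2⟩, ?_⟩
    · intro i hi
      have : i ≠ a := fun h => ha (h ▸ hi)
      simp [this]
    · simp [← h1]
  · intro s _ t _ h
    have := congrFun h a
    simpa using this
  · intro τ hτ
    simp only [Finset.mem_filter] at hτ
    have : Function.update σ a (τ a) = τ := by
      rw [← hτ.2]; simp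
    refine ⟨τ a, ?_, this⟩
    simp only [Finset.mem_filter, Finset.mem_univ, true_and]
    rw [this]
    exact hτ.1.1
  · intros; rfl

lemma refine_all (u : κ → E) (A : Finset κ) (R : (κ → SignType) → Prop)
    (hR : ∀ σ τ, (∀ i ∈ A, σ i = τ i) → R σ → R τ) (B : Finset κ) :
    ∑ σ ∈ (cells u (B ∪ A)).filter R, wt u σ = ∑ σ ∈ (cells u A).filter R, wt u σ := by
  induction B using Finset.induction_on with
  | empty => simp
  | insert a B _ ih =>
    rw [Finset.insert_union]
    by_cases h : a ∈ B ∪ A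
    · rw [Finset.insert_eq_of_mem h, ih]
    · rw [refine_one u _ a h R, ih]
      intro σ τ h
      exact hR σ τ (fun i hi => h i (Finset.mem_union_right _ hi))

lemma refine_univ (u : κ → E) (A : Finset κ) (R : (κ → SignType) → Prop)
    (hR : ∀ σ τ, (∀ i ∈ A, σ i = τ i) → R σ → R τ) :
    ∑ σ ∈ (cells u Finset.univ).filter R, wt u σ = ∑ σ ∈ (cells u A).filter R, wt u σ := by
  rw [← refine_all u A R hR Finset.univ, Finset.union_eq_left.2 (Finset.subset_univ A)]

variable {ι : Type*} [Fintype ι]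

/-- the family `v` together with the combinations `e(v j) v i - e(v i) v j`. -/
def bigFam (v : ι → E) (e : E →ₗ[ℝ] ℝ) : ι ⊕ (ι × ι) → E :=
  Sum.elim v (fun p => e (v p.2) • v p.1 - e (v p.1) • v p.2)

def regR (v : ι → E) (e : E →ₗ[ℝ] ℝ) (σ : ι ⊕ (ι × ι) → SignType) : Prop :=
  ∀ i, 0 ≤ σ (Sum.inl i) ∧ (e (v i) = 0 → σ (Sum.inl i) = 0)

def zeroP (v : ι → E) (e : E →ₗ[ℝ] ℝ) (σ : ι ⊕ (ι × ι) → SignType) : Prop :=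
  ∃ i, e (v i) ≠ 0 ∧ σ (Sum.inl i) = 0

def liftUp (v : ι → E) (e : E →ₗ[ℝ] ℝ) (σ : ι ⊕ (ι × ι) → SignType) : ι ⊕ (ι × ι) → SignType :=
  Sum.elim (fun i => if e (v i) = 0 then 0 else 1) (fun p => σ (Sum.inr p))

lemma e_bigFam_inr (v : ι → E) (e : E →ₗ[ℝ] ℝ) (p : ι × ι) : e (bigFam v e (Sum.inr p)) = 0 := by
  simp [bigFam]; ring

lemma wt_liftUp (v : ι → E) (e : E →ₗ[ℝ] ℝ) (l : E →ₗ[ℝ] ℝ)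
    (hR : regR v e (sgv (bigFam v e) Finset.univ l))
    (hZ : zeroP v e (sgv (bigFam v e) Finset.univ l)) :
    wt (bigFam v e) (sgv (bigFam v e) Finset.univ l) =
      - wt (bigFam v e) (liftUp v e (sgv (bigFam v e) Finset.univ l)) := by
  obtain ⟨k, hk, hk0⟩ := hZ
  set σ := sgv (bigFam v e) Finset.univ l with hσ
  have hker : zsp (bigFam v e) (liftUp v e σ) ≤ LinearMap.ker e := by
    rw [zsp, Submodule.span_le]
    rintro _ ⟨i | p, hi, rfl⟩
    · by_contra h
      have h' : e (v i) ≠ 0 := h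
      simp [liftUp, h'] at hi
    · exact e_bigFam_inr v e p
  have hnot : v k ∉ zsp (bigFam v e) (liftUp v e σ) := fun h => hk (hker h)
  have hlk : l (v k) = 0 := by
    simpa [hσ, sgv, bigFam] using hk0
  have heq : zsp (bigFam v e) σ =
      zsp (bigFam v e) (liftUp v e σ) ⊔ Submodule.span ℝ {v k} := by
    apply le_antisymm
    · rw [zsp, Submodule.span_le]
      rintro _ ⟨i | p, hi, rfl⟩
      · by_cases hei : e (v i) = 0
        · apply Submodule.mem_sup_left
          apply Submodule.subset_span
          exact ⟨Sum.inl i, by simp [liftUp, hei], rfl⟩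
        · have hli : l (v i) = 0 := by
            simpa [hσ, sgv, bigFam] using hi
          have h1 : bigFam v e (Sum.inr (i, k)) ∈ zsp (bigFam v e) (liftUp v e σ) := by
            apply Submodule.subset_span
            refine ⟨Sum.inr (i, k), ?_, rfl⟩
            simp [liftUp, hσ, sgv, bigFam, hli, hlk]
          have h2 : bigFam v e (Sum.inl i) =
              (e (v k))⁻¹ • bigFam v e (Sum.inr (i, k)) + ((e (v k))⁻¹ * e (v i)) • v k := by
            simp only [bigFam, Sum.elim_inl, Sum.elim_inr, smul_sub, smul_smul]
            rw [inv_mul_cancel₀ hk]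
            simp
          rw [h2]
          apply Submodule.add_mem
          · exact Submodule.mem_sup_left (Submodule.smul_mem _ _ h1)
          · exact Submodule.mem_sup_right
              (Submodule.smul_mem _ _ (Submodule.mem_span_singleton_self _))
      · apply Submodule.mem_sup_left
        apply Submodule.subset_span
        exact ⟨Sum.inr p, by simpa [liftUp] using hi, rfl⟩
    · apply sup_le
      · rw [zsp, Submodule.span_le]
        rintro _ ⟨i | p, hi, rfl⟩
        · apply Submodule.subset_span
          refine ⟨Sum.inl i, ?_, rfl⟩
          by_cases hei : e (v i) = 0
          · exact (hR i).2 hei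
          · simp [liftUp, hei] at hi
        · apply Submodule.subset_span
          exact ⟨Sum.inr p, by simpa [liftUp] using hi, rfl⟩
      · rw [Submodule.span_le]
        rintro _ rfl
        exact Submodule.subset_span ⟨Sum.inl k, hk0, rfl⟩
  rw [wt, heq, finrank_sup_singleton _ _ hnot, wt, pow_succ]
  ring

lemma pair_sum (v : ι → E) (e : E →ₗ[ℝ] ℝ) (he : ∀ i, 0 ≤ e (v i)) (i₀ : ι)
    (hi₀ : 0 < e (v i₀)) :
    ∑ σ ∈ (cells (bigFam v e) Finset.univ).filter (regR v e), wt (bigFam v e) σ = 0 := by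
  rw [← Finset.sum_filter_add_sum_filter_not _ (zeroP v e), add_eq_zero_iff_eq_neg,
    ← Finset.sum_neg_distrib]
  apply Finset.sum_bij (fun σ _ => liftUp v e σ)
  · intro σ hσ
    simp only [Finset.mem_filter, mem_cells] at hσ ⊢
    obtain ⟨⟨⟨l, rfl⟩, hR⟩, hZ⟩ := hσ
    refine ⟨⟨⟨l + e, ?_⟩, ?_⟩, ?_⟩
    · ext x
      rcases x with i | p
      · by_cases hei : e (v i) = 0
        · have := (hR i).2 hei
          simp only [sgv, Finset.mem_univ, if_true, bigFam, Sum.elim_inl] at this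
          simp [sgv, bigFam, liftUp, hei, this]
        · have h1 := (hR i).1
          simp only [sgv, Finset.mem_univ, if_true, bigFam, Sum.elim_inl, sign_nonneg_iff] at h1
          have h2 : 0 < e (v i) := lt_of_le_of_ne (he i) (Ne.symm hei)
          have h3 : 0 < l (v i) + e (v i) := by linarith
          simp [sgv, bigFam, liftUp, hei, h3]
      · simp only [sgv, Finset.mem_univ, if_true, LinearMap.add_apply, e_bigFam_inr, liftUp,
          Sum.elim_inr, add_zero]
    · intro i
      by_cases hei : e (v i) = 0
      · simp [liftUp, hei]
      · simp [liftUp, hei]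
    · rintro ⟨i, hi, hi'⟩
      simp [liftUp, hi] at hi'
  · have key : ∀ l, regR v e (sgv (bigFam v e) Finset.univ l) →
        zeroP v e (sgv (bigFam v e) Finset.univ l) → ∀ i, 
        (sgv (bigFam v e) Finset.univ l (Sum.inl i) = 0 ↔
          ∀ j, sgv (bigFam v e) Finset.univ l (Sum.inr (i, j)) ≤ 0) := by
      intro l hR ⟨k, hk, hk0⟩ i
      have hlk : l (v k) = 0 := by simpa [sgv, bigFam] using hk0
      have hnn : ∀ j, 0 ≤ l (v j) := by
        intro j
        simpa [sgv, bigFam] using (hR j).1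
      have hk' : 0 < e (v k) := lt_of_le_of_ne (he k) (Ne.symm hk)
      simp only [sgv, Finset.mem_univ, if_true, bigFam, Sum.elim_inl, Sum.elim_inr,
        sign_eq_zero_iff, sign_nonpos_iff, map_sub, map_smul, smul_eq_mul]
      constructor
      · intro h j
        rw [h]
        nlinarith [mul_nonneg (he i) (hnn j)]
      · intro h
        have := h k
        rw [hlk] at this
        nlinarith [hnn i]
    intro σ hσ τ hτ h
    simp only [Finset.mem_filter, mem_cells] at hσ hτ
    obtain ⟨⟨⟨l, rfl⟩, hR⟩, hZ⟩ := hσ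
    obtain ⟨⟨⟨l', rfl⟩, hR'⟩, hZ'⟩ := hτ
    have hr : ∀ p, sgv (bigFam v e) Finset.univ l (Sum.inr p) =
        sgv (bigFam v e) Finset.univ l' (Sum.inr p) := by
      intro p
      have := congrFun h (Sum.inr p)
      simpa only [liftUp, Sum.elim_inr] using this
    funext x
    rcases x with i | p
    · have h1 := key l hR hZ i
      have h2 := key l' hR' hZ' i
      simp only [hr] at h1
      rw [← h2] at h1
      clear h2
      have h3 := (hR i).1
      have h4 := (hR' i).1
      generalize sgv (bigFam v e) Finset.univ l (Sum.inl i) = s at *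
      generalize sgv (bigFam v e) Finset.univ l' (Sum.inl i) = t at *
      revert s t
      decide
    · exact hr p
  · intro τ hτ
    simp only [Finset.mem_filter, mem_cells] at hτ
    obtain ⟨⟨⟨l, rfl⟩, hR⟩, hZ⟩ := hτ
    obtain ⟨k, hk, hmin⟩ := Finset.exists_min_image
      (Finset.univ.filter (fun i => 0 < e (v i))) (fun i => l (v i) / e (v i)) ⟨i₀, by simpa⟩
    simp only [Finset.mem_filter, Finset.mem_univ, true_and] at hk hmin
    set m := l (v k) / e (v k) with hm
    have hz : ∀ i, e (v i) = 0 → l (v i) = 0 := by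
      intro i hi
      simpa [sgv, bigFam] using (hR i).2 hi
    have hge : ∀ i, 0 ≤ (l - m • e) (v i) := by
      intro i
      simp only [LinearMap.sub_apply, LinearMap.smul_apply, smul_eq_mul]
      rcases (he i).eq_or_lt with h | h
      · rw [hz i h.symm, ← h]; simp
      · have := hmin i h
        rw [le_div_iff₀ h] at this
        linarith
    have hk0 : (l - m • e) (v k) = 0 := by
      simp only [LinearMap.sub_apply, LinearMap.smul_apply, smul_eq_mul, hm]
      field_simp
      ring
    refine ⟨sgv (bigFam v e) Finset.univ (l - m • e), ?_, ?_⟩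
    · simp only [Finset.mem_filter, mem_cells]
      refine ⟨⟨⟨_, rfl⟩, ?_⟩, ⟨k, hk.ne', ?_⟩⟩
      · intro i
        simp only [sgv, Finset.mem_univ, if_true, bigFam, Sum.elim_inl, sign_nonneg_iff,
          sign_eq_zero_iff]
        refine ⟨hge i, fun h => ?_⟩
        simp [h, hz i h]
      · simp only [sgv, Finset.mem_univ, if_true, bigFam, Sum.elim_inl, sign_eq_zero_iff]
        exact hk0
    · funext x
      rcases x with i | p
      · by_cases hei : e (v i) = 0
        · simp [liftUp, hei, (hR i).2 hei]
        · have h1 := (hR i).1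
          have h2 : sgv (bigFam v e) Finset.univ l (Sum.inl i) ≠ 0 := fun h => hZ ⟨i, hei, h⟩
          simp only [liftUp, Sum.elim_inl, hei, if_false]
          generalize sgv (bigFam v e) Finset.univ l (Sum.inl i) = s at *
          revert s
          decide
      · simp only [liftUp, Sum.elim_inr, sgv, Finset.mem_univ, if_true, LinearMap.sub_apply,
          LinearMap.smul_apply, e_bigFam_inr, smul_zero, sub_zero]
  · intro σ hσ
    simp only [Finset.mem_filter, mem_cells] at hσ
    obtain ⟨⟨⟨l, rfl⟩, hR⟩, hZ⟩ := hσ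
    exact wt_liftUp v e l hR hZ

/-- `S` is (the index set of) a face of the cone generated by `v`. -/
def IsCFace (v : ι → E) (S : Set ι) : Prop :=
  ∃ l : E →ₗ[ℝ] ℝ, (∀ i, 0 ≤ l (v i)) ∧ ∀ i, i ∈ S ↔ l (v i) = 0

lemma cface_sum (v : ι → E) (e : E →ₗ[ℝ] ℝ) (he : ∀ i, 0 ≤ e (v i)) (i₀ : ι)
    (hi₀ : 0 < e (v i₀)) :
    ∑ S ∈ (Finset.univ : Finset (Set ι)).filter
      (fun S => IsCFace v S ∧ ∀ i, e (v i) = 0 → i ∈ S),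
      (-1 : ℤ) ^ (Module.finrank ℝ (Submodule.span ℝ (v '' S))) = 0 := by
  rw [← pair_sum v e he i₀ hi₀]
  set A : Finset (ι ⊕ (ι × ι)) := Finset.univ.filter (fun x => x.isLeft = true) with hA
  have hAl : ∀ i, (Sum.inl i : ι ⊕ (ι × ι)) ∈ A := by simp [hA]
  have hAr : ∀ p, (Sum.inr p : ι ⊕ (ι × ι)) ∉ A := by simp [hA]
  have := refine_univ (bigFam v e) A (regR v e) (by
    intro σ τ h hr i
    rw [← h _ (hAl i)]
    exact hr i)
  rw [this]
  symm
  apply Finset.sum_bij (fun σ _ => {i | σ (Sum.inl i) = 0})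
  · intro σ hσ
    simp only [Finset.mem_filter, mem_cells, Finset.mem_univ, true_and] at hσ ⊢
    obtain ⟨⟨l, rfl⟩, hR⟩ := hσ
    refine ⟨⟨l, fun i => ?_, fun i => ?_⟩, fun i hi => (hR i).2 hi⟩
    · simpa [sgv, bigFam, hAl] using (hR i).1
    · simp [sgv, bigFam, hAl]
  · intro σ hσ τ hτ h
    simp only [Finset.mem_filter, mem_cells] at hσ hτ
    obtain ⟨⟨l, rfl⟩, hR⟩ := hσ
    obtain ⟨⟨l', rfl⟩, hR'⟩ := hτ
    funext x
    rcases x with i | p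
    · have h1 : sgv (bigFam v e) A l (Sum.inl i) = 0 ↔ sgv (bigFam v e) A l' (Sum.inl i) = 0 :=
        Set.ext_iff.1 h i
      have h3 := (hR i).1
      have h4 := (hR' i).1
      generalize sgv (bigFam v e) A l (Sum.inl i) = s at *
      generalize sgv (bigFam v e) A l' (Sum.inl i) = t at *
      clear h hR hR' this
      revert s t
      decide
    · simp [sgv, hAr]
  · intro S hS
    simp only [Finset.mem_filter, Finset.mem_univ, true_and] at hS
    obtain ⟨⟨l, h1, h2⟩, h3⟩ := hS
    refine ⟨sgv (bigFam v e) A l, ?_, ?_⟩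
    · simp only [Finset.mem_filter, mem_cells]
      refine ⟨⟨l, rfl⟩, fun i => ?_⟩
      simp only [sgv, hAl, if_true, bigFam, Sum.elim_inl, sign_nonneg_iff, sign_eq_zero_iff]
      exact ⟨h1 i, fun h => (h2 i).1 (h3 i h)⟩
    · ext i
      simp [sgv, hAl, bigFam, h2]
  · intro σ hσ
    simp only [Finset.mem_filter, mem_cells] at hσ
    obtain ⟨⟨l, rfl⟩, hR⟩ := hσ
    rw [wt, zsp]
    have : bigFam v e '' {x | sgv (bigFam v e) A l x = 0} =
        v '' {i | sgv (bigFam v e) A l (Sum.inl i) = 0} := by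
      ext y
      constructor
      · rintro ⟨i | p, hi, rfl⟩
        · exact ⟨i, hi, rfl⟩
        · simp [sgv, hAr] at hi
      · rintro ⟨i, hi, rfl⟩
        exact ⟨Sum.inl i, hi, rfl⟩
    rw [this]

lemma cface_cover (v : ι → E) (e : E →ₗ[ℝ] ℝ) (he : ∀ i, 0 ≤ e (v i)) (i₀ : ι)
    (hi₀ : 0 < e (v i₀))
    (hcov : ∀ l : E →ₗ[ℝ] ℝ, (∀ i, 0 ≤ l (v i)) → (∀ i, e (v i) = 0 → l (v i) = 0) →
      (∃ i, e (v i) ≠ 0 ∧ l (v i) = 0) → ∀ i, l (v i) = 0) :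
    Module.finrank ℝ (Submodule.span ℝ (Set.range v)) =
      Module.finrank ℝ (Submodule.span ℝ (v '' {i | e (v i) = 0})) + 1 := by
  set Z := Submodule.span ℝ (v '' {i | e (v i) = 0}) with hZ
  have hnot : v i₀ ∉ Z := by
    have : Z ≤ LinearMap.ker e := by
      rw [hZ, Submodule.span_le]
      rintro _ ⟨i, hi, rfl⟩
      exact hi
    exact fun h => hi₀.ne' (this h)
  rw [← finrank_sup_singleton Z _ hnot]
  suffices h : Submodule.span ℝ (Set.range v) = Z ⊔ Submodule.span ℝ {v i₀} by rw [h]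
  apply le_antisymm
  · rw [Submodule.span_le]
    rintro _ ⟨j, rfl⟩
    by_contra hj
    obtain ⟨f, hf, hf1⟩ := exists_dual_sep _ _ hj
    obtain ⟨k, hk, hmax⟩ := Finset.exists_max_image
      (Finset.univ.filter (fun i => 0 < e (v i))) (fun i => f (v i) / e (v i)) ⟨i₀, by simpa⟩
    simp only [Finset.mem_filter, Finset.mem_univ, true_and] at hk hmax
    set m := f (v k) / e (v k) with hm
    have hfz : ∀ i, e (v i) = 0 → f (v i) = 0 := fun i hi =>
      hf _ (Submodule.mem_sup_left (Submodule.subset_span ⟨i, hi, rfl⟩))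
    have hf0 : f (v i₀) = 0 :=
      hf _ (Submodule.mem_sup_right (Submodule.mem_span_singleton_self _))
    have hej : 0 < e (v j) := by
      refine lt_of_le_of_ne (he j) (fun h => ?_)
      have := hfz j h.symm
      rw [this] at hf1
      exact zero_ne_one hf1
    have hmpos : 0 < m := by
      have := hmax j hej
      rw [hf1] at this
      exact lt_of_lt_of_le (by positivity) this
    have := hcov (m • e - f) (fun i => ?_) (fun i hi => ?_) ⟨k, hk.ne', ?_⟩ i₀
    · simp [hf0, hmpos.ne', hi₀.ne'] at this
    · simp only [LinearMap.sub_apply, LinearMap.smul_apply, smul_eq_mul]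
      rcases (he i).eq_or_lt with h | h
      · rw [hfz i h.symm, ← h]; simp
      · have := hmax i h
        rw [div_le_iff₀ h] at this
        linarith
    · simp [hi, hfz i hi]
    · simp only [LinearMap.sub_apply, LinearMap.smul_apply, smul_eq_mul, hm]
      field_simp
      ring
  · apply sup_le
    · exact Submodule.span_mono (Set.image_subset_range _ _)
    · rw [Submodule.span_le]
      rintro _ rfl
      exact Submodule.subset_span ⟨i₀, rfl⟩

end LA


def hat {n : ℕ} (x : Euc n) : Euc n × ℝ := (x, 1)

lemma finrank_span_hat {n : ℕ} (T : Set (Euc n)) (hT : T.Nonempty) :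
    Module.finrank ℝ (Submodule.span ℝ (hat '' T)) = Module.finrank ℝ (vectorSpan ℝ T) + 1 := by
  obtain ⟨x₀, hx₀⟩ := hT
  set W : Submodule ℝ (Euc n × ℝ) :=
    (vectorSpan ℝ T).map (LinearMap.inl ℝ (Euc n) ℝ) with hW
  have hnot : hat x₀ ∉ W := by
    rintro ⟨y, _, hy⟩
    have := congrArg Prod.snd hy
    simp [hat] at this
  have hWr : Module.finrank ℝ W = Module.finrank ℝ (vectorSpan ℝ T) :=
    (Submodule.equivMapOfInjective _ LinearMap.inl_injective _).symm.finrank_eq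
  rw [← hWr, ← finrank_sup_singleton W _ hnot]
  suffices h : Submodule.span ℝ (hat '' T) = W ⊔ Submodule.span ℝ {hat x₀} by rw [h]
  apply le_antisymm
  · rw [Submodule.span_le]
    rintro _ ⟨x, hx, rfl⟩
    have : hat x = LinearMap.inl ℝ (Euc n) ℝ (x -ᵥ x₀) + hat x₀ := by
      simp [hat]
    rw [this]
    apply Submodule.add_mem
    · exact Submodule.mem_sup_left
        (Submodule.mem_map_of_mem (vsub_mem_vectorSpan ℝ hx hx₀))
    · exact Submodule.mem_sup_right (Submodule.mem_span_singleton_self _)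
  · apply sup_le
    · rw [hW, vectorSpan_def, Submodule.map_span, Submodule.span_le]
      rintro _ ⟨_, ⟨x, hx, y, hy, rfl⟩, rfl⟩
      have : LinearMap.inl ℝ (Euc n) ℝ (x -ᵥ y) = hat x - hat y := by
        simp [hat]
      simp only
      rw [this]
      exact Submodule.sub_mem _ (Submodule.subset_span ⟨x, hx, rfl⟩)
        (Submodule.subset_span ⟨y, hy, rfl⟩)
    · rw [Submodule.span_le]
      rintro _ rfl
      exact Submodule.subset_span ⟨x₀, hx₀, rfl⟩

lemma L_hat {n : ℕ} (L : Euc n × ℝ →ₗ[ℝ] ℝ) (x : Euc n) :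
    L (hat x) = L (x, 0) + L (0, 1) := by
  rw [← map_add]; simp [hat]

lemma exposed_functional {n : ℕ} (P : Set (Euc n)) (H : Set (Euc n)) (hH : IsExposed ℝ P H) :
    ∃ L : Euc n × ℝ →ₗ[ℝ] ℝ, (∀ x ∈ P, 0 ≤ L (hat x)) ∧ H = {x ∈ P | L (hat x) = 0} := by
  rcases H.eq_empty_or_nonempty with rfl | hne
  · refine ⟨LinearMap.snd ℝ _ _, ?_, ?_⟩
    · simp [hat]
    · simp [hat]
  · obtain ⟨l, hl⟩ := hH hne
    obtain ⟨x₀, hx₀⟩ := hne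
    rw [hl] at hx₀
    refine ⟨(l x₀) • LinearMap.snd ℝ _ _ - l.toLinearMap ∘ₗ LinearMap.fst ℝ _ _, ?_, ?_⟩
    · intro x hx
      simpa [hat] using hx₀.2 x hx
    · rw [hl]
      ext x
      simp only [Set.mem_ofPred_eq, hat]
      refine and_congr_right (fun hx => ?_)
      have h1 := hx₀.2 x hx
      constructor
      · intro h
        have := h x₀ hx₀.1
        simp; linarith
      · intro h y hy
        have := hx₀.2 y hy
        simp at h; linarith

lemma hat_nonneg_hull {n : ℕ} (V : Finset (Euc n)) (L : Euc n × ℝ →ₗ[ℝ] ℝ)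
    (h : ∀ x ∈ V, 0 ≤ L (hat x)) : ∀ x ∈ convexHull ℝ (V : Set (Euc n)), 0 ≤ L (hat x) := by
  intro x hx
  rw [Finset.mem_convexHull'] at hx
  obtain ⟨w, hw, hw1, rfl⟩ := hx
  have : hat (∑ y ∈ V, w y • y) = ∑ y ∈ V, w y • hat y := by
    refine Prod.ext ?_ ?_
    · simp [hat, Prod.fst_sum]
    · simp [hat, Prod.snd_sum, hw1]
  rw [this, map_sum]
  apply Finset.sum_nonneg
  intro y hy
  simpa using mul_nonneg (hw y hy) (h y hy)

lemma exposed_of_functional {n : ℕ} (V : Finset (Euc n)) (L : Euc n × ℝ →ₗ[ℝ] ℝ)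
    (h : ∀ x ∈ V, 0 ≤ L (hat x)) :
    IsExposed ℝ (convexHull ℝ (V : Set (Euc n)))
      {x ∈ convexHull ℝ (V : Set (Euc n)) | L (hat x) = 0} := by
  rintro ⟨x₀, hx₀, hx₀'⟩
  have hnn := hat_nonneg_hull V L h
  refine ⟨LinearMap.toContinuousLinearMap (- (L ∘ₗ LinearMap.inl ℝ _ _)), ?_⟩
  ext x
  simp only [Set.mem_ofPred_eq]
  refine and_congr_right (fun hx => ?_)
  simp only [LinearMap.coe_toContinuousLinearMap', LinearMap.neg_apply, LinearMap.comp_apply,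
    LinearMap.inl_apply]
  have e0 := L_hat L x₀
  have e1 := L_hat L x
  constructor
  · intro hz y hy
    have := hnn y hy
    have e2 := L_hat L y
    linarith
  · intro hz
    have := hz x₀ hx₀
    have := hnn x hx
    linarith

lemma exposed_eq_hull {n : ℕ} (V : Finset (Euc n)) (H : Set (Euc n))
    (hH : IsExposed ℝ (convexHull ℝ (V : Set (Euc n))) H) :
    H = convexHull ℝ ((V : Set (Euc n)) ∩ H) := by
  obtain ⟨L, hL, hHL⟩ := exposed_functional _ _ hH
  apply Set.Subset.antisymm
  · intro x hx
    have hx' := hx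
    rw [hHL] at hx'
    obtain ⟨hxP, hx0⟩ := hx'
    rw [Finset.mem_convexHull'] at hxP
    obtain ⟨w, hw, hw1, rfl⟩ := hxP
    have : hat (∑ y ∈ V, w y • y) = ∑ y ∈ V, w y • hat y := by
      refine Prod.ext ?_ ?_
      · simp [hat, Prod.fst_sum]
      · simp [hat, Prod.snd_sum, hw1]
    rw [this, map_sum, Finset.sum_eq_zero_iff_of_nonneg] at hx0
    · have e1 : ∑ y ∈ V, w y • y = ∑ y ∈ V.filter (fun y => w y ≠ 0), w y • y := by
        symm
        apply Finset.sum_filter_of_ne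
        intro y _ h h0
        simp [h0] at h
      rw [e1]
      apply (convex_convexHull ℝ _).sum_mem
      · intro y hy
        exact hw y (Finset.mem_filter.1 hy).1
      · rw [← hw1]
        exact Finset.sum_filter_ne_zero V
      · intro y hy
        rw [Finset.mem_filter] at hy
        apply subset_convexHull
        refine ⟨hy.1, ?_⟩
        rw [hHL]
        refine ⟨subset_convexHull ℝ _ hy.1, ?_⟩
        have := hx0 y hy.1
        simpa [hy.2] using this
    · intro y hy
      simpa using mul_nonneg (hw y hy) (hL y (subset_convexHull ℝ _ hy))
  · have hc : Convex ℝ H := hH.convex (convex_convexHull ℝ _)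
    exact convexHull_min Set.inter_subset_right hc

lemma faceRank_eq {n : ℕ} (V : Finset (Euc n)) (H : Set (Euc n))
    (hH : IsExposed ℝ (convexHull ℝ (V : Set (Euc n))) H) :
    faceRank H = Module.finrank ℝ (Submodule.span ℝ (hat '' ((V : Set (Euc n)) ∩ H))) := by
  have hh := exposed_eq_hull V H hH
  unfold faceRank
  split_ifs with h
  · rw [h, Set.inter_empty, Set.image_empty, Submodule.span_empty, finrank_bot]
  · have hne : ((V : Set (Euc n)) ∩ H).Nonempty := by
      by_contra h'
      rw [Set.not_nonempty_iff_eq_empty] at h'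
      rw [h', convexHull_empty] at hh
      exact h hh
    rw [finrank_span_hat _ hne, pdim]
    congr 1
    conv_lhs => rw [hh]
    rw [← direction_affineSpan, affineSpan_convexHull, direction_affineSpan]

lemma exposed_subset {n : ℕ} (V : Finset (Euc n)) (H G : Set (Euc n))
    (hH : IsExposed ℝ (convexHull ℝ (V : Set (Euc n))) H)
    (hG : IsExposed ℝ (convexHull ℝ (V : Set (Euc n))) G)
    (h : ∀ x ∈ V, x ∈ H → x ∈ G) : H ⊆ G := by
  rw [exposed_eq_hull V H hH]
  exact convexHull_min (fun x hx => h x hx.1 hx.2) (hG.convex (convex_convexHull ℝ _))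

lemma exists_face {n : ℕ} (V : Finset (Euc n)) (G : Set (Euc n))
    (hG : IsExposed ℝ (convexHull ℝ (V : Set (Euc n))) G) (L : Euc n × ℝ →ₗ[ℝ] ℝ)
    (hL : ∀ x ∈ V, x ∈ G → 0 ≤ L (hat x)) :
    ∃ H, IsExposed ℝ (convexHull ℝ (V : Set (Euc n))) H ∧ H ⊆ G ∧
      ∀ x ∈ V, x ∈ G → (x ∈ H ↔ L (hat x) = 0) := by
  obtain ⟨g, hg, hgG⟩ := exposed_functional _ _ hG
  have hV : ∀ x ∈ V, x ∈ convexHull ℝ (V : Set (Euc n)) := fun x hx => subset_convexHull ℝ _ hx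
  have hgz : ∀ x ∈ V, (x ∈ G ↔ g (hat x) = 0) := by
    intro x hx
    rw [hgG]
    simp [hV x hx]
  obtain ⟨ε, hε, hs⟩ := perturb_sign (fun x : {x // x ∈ V} => g (hat x.1)) (fun x => L (hat x.1))
  have hout : ∀ x ∈ V, x ∉ G → 0 < (g + ε • L) (hat x) := by
    intro x hx hxG
    have h1 : g (hat x) ≠ 0 := fun h => hxG ((hgz x hx).2 h)
    have h2 : 0 < g (hat x) := lt_of_le_of_ne (hg x (hV x hx)) h1.symm
    have := (hs ⟨x, hx⟩ h1).1
    simp only [sign_pos h2, sign_eq_one_iff] at this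
    simpa using this
  have hin : ∀ x ∈ V, x ∈ G → (g + ε • L) (hat x) = ε * L (hat x) := by
    intro x hx hxG
    simp [(hgz x hx).1 hxG]
  have hnn : ∀ x ∈ V, 0 ≤ (g + ε • L) (hat x) := by
    intro x hx
    by_cases hxG : x ∈ G
    · rw [hin x hx hxG]
      exact mul_nonneg hε.le (hL x hx hxG)
    · exact (hout x hx hxG).le
  have hexp := exposed_of_functional V (g + ε • L) hnn
  refine ⟨_, hexp, ?_, ?_⟩
  · apply exposed_subset V _ _ hexp hG
    intro x hx hxH
    by_contra hxG
    exact (hout x hx hxG).ne' hxH.2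
  · intro x hx hxG
    rw [Set.mem_ofPred_eq, hin x hx hxG]
    simp [hV x hx, hε.ne']

/-- the homogenized vertices of the face `G`. -/
def vfam {n : ℕ} (V : Finset (Euc n)) (G : Set (Euc n)) :
    {x // x ∈ V.filter (fun x => x ∈ G)} → Euc n × ℝ := fun x => hat x.1

lemma vfam_image {n : ℕ} (V : Finset (Euc n)) (G H : Set (Euc n)) (hHG : H ⊆ G) :
    vfam V G '' {i | i.1 ∈ H} = hat '' ((V : Set (Euc n)) ∩ H) := by
  ext y
  constructor
  · rintro ⟨i, hi, rfl⟩
    exact ⟨i.1, ⟨(Finset.mem_filter.1 i.2).1, hi⟩, rfl⟩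
  · rintro ⟨x, ⟨hx, hxH⟩, rfl⟩
    exact ⟨⟨x, Finset.mem_filter.2 ⟨hx, hHG hxH⟩⟩, hxH, rfl⟩

/-- The set of exposed faces in an interval. -/
def interval {n : ℕ} (P F G : Set (Euc n)) : Set (Set (Euc n)) :=
  {H | IsExposed ℝ P H ∧ F ⊆ H ∧ H ⊆ G}

lemma exposed_finite {n : ℕ} (V : Finset (Euc n)) :
    {H | IsExposed ℝ (convexHull ℝ (V : Set (Euc n))) H}.Finite := by
  apply Set.Finite.subset ((V.finite_toSet.finite_subsets).image (fun T => convexHull ℝ T))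
  intro H hH
  exact ⟨_, Set.inter_subset_left, (exposed_eq_hull V H hH).symm⟩

lemma interval_finite {n : ℕ} (V : Finset (Euc n)) (F G : Set (Euc n)) :
    (interval (convexHull ℝ (V : Set (Euc n))) F G).Finite :=
  (exposed_finite V).subset (fun _ h => h.1)

/-- A functional on the homogenized vertices of `G` cutting out `F`. -/
lemma exists_e {n : ℕ} (V : Finset (Euc n)) (F G : Set (Euc n))
    (hF : IsExposed ℝ (convexHull ℝ (V : Set (Euc n))) F)
    (hG : IsExposed ℝ (convexHull ℝ (V : Set (Euc n))) G) (hFG : F ⊂ G) :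
    ∃ e : Euc n × ℝ →ₗ[ℝ] ℝ, (∀ i, 0 ≤ e (vfam V G i)) ∧ (∃ i, 0 < e (vfam V G i)) ∧
      ∀ i, e (vfam V G i) = 0 ↔ i.1 ∈ F := by
  obtain ⟨f, hf, hfF⟩ := exposed_functional _ _ hF
  have hV : ∀ x ∈ V, x ∈ convexHull ℝ (V : Set (Euc n)) := fun x hx => subset_convexHull ℝ _ hx
  have hfz : ∀ x ∈ V, (f (hat x) = 0 ↔ x ∈ F) := by
    intro x hx
    rw [hfF]
    simp [hV x hx]
  have hiV : ∀ i : {x // x ∈ V.filter (fun x => x ∈ G)}, i.1 ∈ V :=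
    fun i => (Finset.mem_filter.1 i.2).1
  refine ⟨f, fun i => hf _ (hV _ (hiV i)), ?_, fun i => hfz _ (hiV i)⟩
  by_contra hcon
  push Not at hcon
  apply hFG.2
  apply exposed_subset V G F hG hF
  intro x hx hxG
  have h1 := hcon ⟨x, Finset.mem_filter.2 ⟨hx, hxG⟩⟩
  have h2 := hf x (hV x hx)
  exact (hfz x hx).1 (le_antisymm h1 h2)

lemma interval_sum {n : ℕ} (V : Finset (Euc n)) (F G : Set (Euc n))
    (hF : IsExposed ℝ (convexHull ℝ (V : Set (Euc n))) F)
    (hG : IsExposed ℝ (convexHull ℝ (V : Set (Euc n))) G) (hFG : F ⊂ G) :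
    ∑ H ∈ (interval_finite V F G).toFinset, (-1 : ℤ) ^ faceRank H = 0 := by
  obtain ⟨e, he, ⟨i₀, hi₀⟩, hez⟩ := exists_e V F G hF hG hFG
  rw [← cface_sum (vfam V G) e he i₀ hi₀]
  have hiV : ∀ i : {x // x ∈ V.filter (fun x => x ∈ G)}, i.1 ∈ V ∧ i.1 ∈ G :=
    fun i => (Finset.mem_filter.1 i.2)
  apply Finset.sum_bij (fun H _ => {i | i.1 ∈ H})
  · intro H hH
    rw [Set.Finite.mem_toFinset] at hH
    obtain ⟨hH, hFH, hHG⟩ := hH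
    simp only [Finset.mem_filter, Finset.mem_univ, true_and]
    refine ⟨?_, fun i hi => hFH ((hez i).1 hi)⟩
    obtain ⟨L, hL, hHL⟩ := exposed_functional _ _ hH
    refine ⟨L, fun i => hL _ (subset_convexHull ℝ _ (hiV i).1), fun i => ?_⟩
    rw [Set.mem_ofPred_eq, hHL]
    have : i.1 ∈ convexHull ℝ (V : Set (Euc n)) := subset_convexHull ℝ _ (hiV i).1
    simp [this, vfam]
  · intro H hH K hK h
    rw [Set.Finite.mem_toFinset] at hH hK
    apply Set.Subset.antisymm
    · apply exposed_subset V _ _ hH.1 hK.1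
      intro x hx hxH
      exact (Set.ext_iff.1 h ⟨x, Finset.mem_filter.2 ⟨hx, hH.2.2 hxH⟩⟩).1 hxH
    · apply exposed_subset V _ _ hK.1 hH.1
      intro x hx hxH
      exact (Set.ext_iff.1 h ⟨x, Finset.mem_filter.2 ⟨hx, hK.2.2 hxH⟩⟩).2 hxH
  · intro S hS
    simp only [Finset.mem_filter, Finset.mem_univ, true_and] at hS
    obtain ⟨⟨L, hL, hLS⟩, hS2⟩ := hS
    obtain ⟨H, hH, hHG, hHL⟩ := exists_face V G hG L
      (fun x hx hxG => hL ⟨x, Finset.mem_filter.2 ⟨hx, hxG⟩⟩)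
    have hHS : {i : {x // x ∈ V.filter (fun x => x ∈ G)} | i.1 ∈ H} = S := by
      ext i
      rw [Set.mem_ofPred_eq, hHL _ (hiV i).1 (hiV i).2, hLS]
      rfl
    refine ⟨H, ?_, hHS⟩
    rw [Set.Finite.mem_toFinset]
    refine ⟨hH, ?_, hHG⟩
    apply exposed_subset V _ _ hF hH
    intro x hx hxF
    have h1 := hS2 ⟨x, Finset.mem_filter.2 ⟨hx, hFG.1 hxF⟩⟩ ((hez _).2 hxF)
    rw [← hHS] at h1
    exact h1
  · intro H hH
    rw [Set.Finite.mem_toFinset] at hH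
    rw [faceRank_eq V H hH.1, vfam_image V G H hH.2.2]

lemma cover_rank {n : ℕ} (V : Finset (Euc n)) (F G : Set (Euc n))
    (hF : IsExposed ℝ (convexHull ℝ (V : Set (Euc n))) F)
    (hG : IsExposed ℝ (convexHull ℝ (V : Set (Euc n))) G) (hFG : F ⊂ G)
    (hcov : ¬ ∃ H : Set (Euc n), IsExposed ℝ (convexHull ℝ (V : Set (Euc n))) H ∧ F ⊂ H ∧ H ⊂ G) :
    faceRank G = faceRank F + 1 := by
  obtain ⟨e, he, ⟨i₀, hi₀⟩, hez⟩ := exists_e V F G hF hG hFG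
  have hiV : ∀ i : {x // x ∈ V.filter (fun x => x ∈ G)}, i.1 ∈ V ∧ i.1 ∈ G :=
    fun i => (Finset.mem_filter.1 i.2)
  have key := cface_cover (vfam V G) e he i₀ hi₀ (by
    intro L hL hLe ⟨k, hk, hk0⟩ i
    by_contra hi
    obtain ⟨H, hH, hHG, hHL⟩ := exists_face V G hG L
      (fun x hx hxG => hL ⟨x, Finset.mem_filter.2 ⟨hx, hxG⟩⟩)
    apply hcov
    refine ⟨H, hH, ⟨?_, ?_⟩, ⟨hHG, ?_⟩⟩
    · apply exposed_subset V _ _ hF hH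
      intro x hx hxF
      exact (hHL x hx (hFG.1 hxF)).2
        (hLe ⟨x, Finset.mem_filter.2 ⟨hx, hFG.1 hxF⟩⟩ ((hez _).2 hxF))
    · intro hHF
      exact hk ((hez k).2 (hHF ((hHL _ (hiV k).1 (hiV k).2).2 hk0)))
    · intro hGH
      exact hi ((hHL _ (hiV i).1 (hiV i).2).1 (hGH (hiV i).2)))
  rw [faceRank_eq V G hG, faceRank_eq V F hF, ← vfam_image V G G subset_rfl,
    ← vfam_image V G F hFG.1]
  have h1 : {i : {x // x ∈ V.filter (fun x => x ∈ G)} | i.1 ∈ G} = Set.univ :=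
    Set.eq_univ_of_forall (fun i => (hiV i).2)
  have h2 : {i : {x // x ∈ V.filter (fun x => x ∈ G)} | i.1 ∈ F} = {i | e (vfam V G i) = 0} := by
    ext i
    exact (hez i).symm
  rw [h1, h2, Set.image_univ]
  exact key

theorem statement11 {n : ℕ} (P : Set (Euc n)) (hP : IsPolytope P) (hne : P.Nonempty) :
    -- bounded: the empty face and P itself are faces
    IsExposed ℝ P (∅ : Set (Euc n)) ∧ IsExposed ℝ P P ∧
    -- graded with rank function ρ(Q) = dim Q + 1: covering relations in the face poset
    -- raise the rank by exactly one
    (∀ F G : Set (Euc n), IsExposed ℝ P F → IsExposed ℝ P G → F ⊂ G →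
      (¬ ∃ H : Set (Euc n), IsExposed ℝ P H ∧ F ⊂ H ∧ H ⊂ G) →
      faceRank G = faceRank F + 1) ∧
    -- Eulerian: each nontrivial interval [F,G] of the face poset has as many faces of
    -- odd rank as of even rank
    (∀ F G : Set (Euc n), IsExposed ℝ P F → IsExposed ℝ P G → F ⊂ G →
      {H : Set (Euc n) | IsExposed ℝ P H ∧ F ⊆ H ∧ H ⊆ G ∧ Odd (faceRank H)}.ncard =
      {H : Set (Euc n) | IsExposed ℝ P H ∧ F ⊆ H ∧ H ⊆ G ∧ Even (faceRank H)}.ncard) := by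
  obtain ⟨V, rfl⟩ := hP
  refine ⟨fun h => absurd h Set.not_nonempty_empty, fun _ => ⟨0, by simp⟩, ?_, ?_⟩
  · intro F G hF hG hFG hcov
    exact cover_rank V F G hF hG hFG hcov
  · intro F G hF hG hFG
    have hs := interval_sum V F G hF hG hFG
    set I := (interval_finite V F G).toFinset with hI
    have h1 : {H : Set (Euc n) | IsExposed ℝ (convexHull ℝ (V : Set (Euc n))) H ∧ F ⊆ H ∧ H ⊆ G ∧
        Odd (faceRank H)} = ((I.filter (fun H => Odd (faceRank H)) : Finset _) : Set _) := by
      ext H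
      simp [hI, interval, and_assoc]
    have h2 : {H : Set (Euc n) | IsExposed ℝ (convexHull ℝ (V : Set (Euc n))) H ∧ F ⊆ H ∧ H ⊆ G ∧
        Even (faceRank H)} = ((I.filter (fun H => ¬ Odd (faceRank H)) : Finset _) : Set _) := by
      ext H
      simp [hI, interval, and_assoc]
    rw [h1, h2, Set.ncard_coe_finset, Set.ncard_coe_finset]
    rw [← Finset.sum_filter_add_sum_filter_not I (fun H => Odd (faceRank H))] at hs
    have e1 : ∑ H ∈ I.filter (fun H => Odd (faceRank H)), (-1 : ℤ) ^ faceRank H =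
        - ((I.filter (fun H => Odd (faceRank H))).card : ℤ) := by
      rw [Finset.sum_congr rfl (fun H hH => Odd.neg_one_pow (Finset.mem_filter.1 hH).2)]
      simp
    have e2 : ∑ H ∈ I.filter (fun H => ¬ Odd (faceRank H)), (-1 : ℤ) ^ faceRank H =
        ((I.filter (fun H => ¬ Odd (faceRank H))).card : ℤ) := by
      rw [Finset.sum_congr rfl (fun H hH =>
        Even.neg_one_pow (Nat.not_odd_iff_even.1 (Finset.mem_filter.1 hH).2))]
      simp
    rw [e1, e2] at hs
    omega
end
end
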